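/- If 1 < p ≤ q < ∞ and E, F are closed infinite dimensional subspaces of ℓ_p and ℓ_q respectively, then L(E;F) does not have the approximation property. -/

import Mathlib

open scoped ENNReal

noncomputable section

/-- A normed space `E` has the approximation property if for every compact set `K` and `ε > 0`
there is a finite rank bounded operator `T : E → E` with `‖T x - x‖ < ε` on `K`. -/
def HasAP (𝕜 E : Type*) [NontriviallyNormedField 𝕜] [SeminormedAddCommGroup E]
    [NormedSpace 𝕜 E] : Prop :=
  ∀ K : Set E, IsCompact K → ∀ ε : ℝ, 0 < ε →
    ∃ T : E →L[𝕜] E, FiniteDimensional 𝕜 (LinearMap.range (T : E →ₗ[𝕜] E)) ∧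
      ∀ x ∈ K, ‖T x - x‖ < ε

namespace APx

/-- combinatorial system on bits -/
structure Sys where
  D : ℕ → ℕ
  a : (n : ℕ) → Fin 3 × Fin (D n) → ℕ
  b : (n : ℕ) → Fin 3 × Fin (D n) → ℕ
  a_inj : ∀ n, Function.Injective (a n)
  b_inj : ∀ n, Function.Injective (b n)
  a_lt : ∀ n j, a n j < n
  b_lt : ∀ n j, b n j < n
  VS : ℕ → Set ℕ
  VT : ℕ → Set ℕ
  a_mem : ∀ n j, a n j ∈ VS n
  b_mem : ∀ n j, b n j ∈ VT n
  VS_up : ∀ n m j, n < m → a m j ∈ VS n → m ∈ VS n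
  VT_up : ∀ n m j, n < m → b m j ∈ VT n → m ∈ VT n
  star : ∀ n m j j', n < m → a m j ∈ VS n → b m j' ∈ VT n → False
  growth : ∀ K : ℕ, ∃ N : ℕ, ∀ n ≥ N, K * Nat.log 2 n ≤ D n

abbrev Lt := Bool × Bool × Bool

def eL : Lt ≃ Fin 8 := Fintype.equivFinOfCardEq rfl

def dec : ℕ → List Lt
  | 0 => []
  | n + 1 => eL.symm ⟨n % 8, Nat.mod_lt _ (by norm_num)⟩ :: dec (n / 8)
decreasing_by omega

def code : List Lt → ℕ
  | [] => 0
  | c :: w => 8 * code w + (eL c : ℕ) + 1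

lemma dec_code (w : List Lt) : dec (code w) = w := by
  induction w with
  | nil => simp [code, dec]
  | cons c w ih =>
    have h := (eL c).2
    rw [code, dec]
    have h1 : (8 * code w + (eL c : ℕ)) / 8 = code w := by omega
    have h2 : (8 * code w + (eL c : ℕ)) % 8 = eL c := by omega
    rw [h1, ih]
    congr 1
    rw [Equiv.symm_apply_eq]
    exact Fin.ext h2

lemma dec_len_mono : ∀ (m n : ℕ), n ≤ m → (dec n).length ≤ (dec m).length := by
  intro m
  induction m using Nat.strong_induction_on with
  | _ m ih =>
    intro n h
    rcases n with _ | n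
    · simp [dec]
    · rcases m with _ | m
      · omega
      · rw [dec, dec]
        simp only [List.length_cons, add_le_add_iff_right]
        exact ih _ (by omega) _ (by omega)

lemma dec_inj : Function.Injective dec := by
  intro n
  induction n using Nat.strong_induction_on with
  | _ n ih =>
    intro m h
    rcases n with _ | n
    · rcases m with _ | m
      · rfl
      · rw [dec, dec] at h; simp at h
    · rcases m with _ | m
      · rw [dec, dec] at h; simp at h
      · rw [dec, dec] at h
        simp only [List.cons.injEq, EmbeddingLike.apply_eq_iff_eq, Fin.mk.injEq] at h
        have := ih (n / 8) (by omega) h.2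
        omega

lemma code_lt (w : List Lt) (n : ℕ) (h : w.length < (dec n).length) : code w < n := by
  by_contra hc
  have := dec_len_mono _ _ (not_lt.1 hc)
  rw [dec_code] at this
  omega

lemma le_pow_len (n : ℕ) : n + 2 ≤ 2 * 8 ^ (dec n).length := by
  induction n using Nat.strong_induction_on with
  | _ n ih =>
    rcases n with _ | n
    · simp [dec]
    · rw [dec]
      have := ih (n / 8) (by omega)
      simp only [List.length_cons, pow_succ]
      omega

def Pf (w : List Lt) : List (Bool × Bool) := w.map fun c => (c.1, c.2.1)
def Qf0 (w : List Lt) : List (Bool × Bool) := w.map fun c => (c.1, c.2.2)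
def flipH : List (Bool × Bool) → List (Bool × Bool)
  | [] => []
  | c :: w => (!c.1, c.2) :: w
def flipF : List Lt → List Lt
  | [] => []
  | c :: w => (!c.1, c.2) :: w
def Qf (w : List Lt) := flipH (Qf0 w)
def yy (w : List Lt) (i : ℕ) : Bool := ((w[i]?).getD default).2.2
def xx (w : List Lt) (i : ℕ) : Bool := ((w[i]?).getD default).2.1
def pw (w : List Lt) := (yy w 0, yy w 1) :: Pf w
def qw (w : List Lt) := (xx w 0, xx w 1) :: Qf w

def mkA (w : List Lt) (v : List Bool) : List Lt := match w with
  | [] => []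
  | c :: w => List.zipWith (fun d y => (d.1, d.2.1, y)) w (c.1 :: c.2.1 :: v)

def mkB (w : List Lt) (v : List Bool) : List Lt := match w with
  | [] => []
  | c :: w => flipF (List.zipWith (fun d x => (d.1, x, d.2.2)) w ((!c.1) :: c.2.2 :: v))

lemma zipA_P (w : List Lt) (v : List Bool) (h : w.length = v.length) :
    Pf (List.zipWith (fun d y => (d.1, d.2.1, y)) w v) = Pf w := by
  induction w generalizing v with
  | nil => simp [Pf]
  | cons c w ih =>
    rcases v with _ | ⟨y, v⟩
    · simp at h
    · have := ih v (by simpa using h)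
      simp only [Pf, List.zipWith_cons_cons, List.map_cons] at this ⊢
      rw [this]

lemma zipB_Q (w : List Lt) (v : List Bool) (h : w.length = v.length) :
    Qf0 (List.zipWith (fun d x => (d.1, x, d.2.2)) w v) = Qf0 w := by
  induction w generalizing v with
  | nil => simp [Qf0]
  | cons c w ih =>
    rcases v with _ | ⟨y, v⟩
    · simp at h
    · have := ih v (by simpa using h)
      simp only [Qf0, List.zipWith_cons_cons, List.map_cons] at this ⊢
      rw [this]

lemma zipA_inj (w : List Lt) (v v' : List Bool) (h : w.length = v.length) (h' : w.length = v'.length)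
    (e : List.zipWith (fun d y => ((d.1, d.2.1, y) : Lt)) w v
      = List.zipWith (fun d y => (d.1, d.2.1, y)) w v') : v = v' := by
  induction w generalizing v v' with
  | nil => simp at h h'; rw [List.length_eq_zero_iff.1 h.symm, List.length_eq_zero_iff.1 h'.symm]
  | cons c w ih =>
    rcases v with _ | ⟨y, v⟩
    · simp at h
    rcases v' with _ | ⟨y', v'⟩
    · simp at h'
    simp only [List.zipWith_cons_cons, List.cons.injEq, Prod.mk.injEq, true_and] at e
    rw [e.1, ih v v' (by simpa using h) (by simpa using h') e.2]

lemma zipB_inj (w : List Lt) (v v' : List Bool) (h : w.length = v.length) (h' : w.length = v'.length)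
    (e : List.zipWith (fun d x => ((d.1, x, d.2.2) : Lt)) w v
      = List.zipWith (fun d x => (d.1, x, d.2.2)) w v') : v = v' := by
  induction w generalizing v v' with
  | nil => simp at h h'; rw [List.length_eq_zero_iff.1 h.symm, List.length_eq_zero_iff.1 h'.symm]
  | cons c w ih =>
    rcases v with _ | ⟨y, v⟩
    · simp at h
    rcases v' with _ | ⟨y', v'⟩
    · simp at h'
    simp only [List.zipWith_cons_cons, List.cons.injEq, Prod.mk.injEq, true_and, and_true] at e
    rw [e.1, ih v v' (by simpa using h) (by simpa using h') e.2]

lemma flipF_inj : Function.Injective flipF := by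
  intro u v h
  rcases u with _ | ⟨c, u⟩ <;> rcases v with _ | ⟨d, v⟩
  · rfl
  · simp [flipF] at h
  · simp [flipF] at h
  · simp only [flipF, List.cons.injEq, Prod.mk.injEq] at h
    obtain ⟨⟨h1, h2⟩, h3⟩ := h
    rw [h3, Prod.ext (by simpa using h1) h2]

lemma Qf_flipF (u : List Lt) : Qf (flipF u) = Qf0 u := by
  rcases u with _ | ⟨c, u⟩ <;> simp [Qf, flipF, Qf0, flipH]

lemma pw_mkA (w : List Lt) (v : List Bool) (h : w.length = v.length + 3) :
    pw (mkA w v) = Pf w := by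
  rcases w with _ | ⟨c, _ | ⟨d, _ | ⟨e, w⟩⟩⟩
  · simp at h
  · simp at h
  · simp at h
  · rw [mkA, pw, zipA_P _ _ (by simpa using h)]
    simp [yy, Pf]

lemma qw_mkB (w : List Lt) (v : List Bool) (h : w.length = v.length + 3) :
    qw (mkB w v) = Qf w := by
  rcases w with _ | ⟨c, _ | ⟨d, _ | ⟨e, w⟩⟩⟩
  · simp at h
  · simp at h
  · simp at h
  · rw [mkB, qw, Qf_flipF, zipB_Q _ _ (by simpa using h)]
    simp [xx, Qf, Qf0, flipF, flipH]

lemma len_mkA (w : List Lt) (v : List Bool) (h : w.length = v.length + 3) :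
    (mkA w v).length < w.length := by
  rcases w with _ | ⟨c, w⟩
  · simp at h
  · simp [mkA]

lemma len_flipF (w : List Lt) : (flipF w).length = w.length := by
  rcases w with _ | ⟨c, w⟩ <;> simp [flipF]

lemma len_mkB (w : List Lt) (v : List Bool) (h : w.length = v.length + 3) :
    (mkB w v).length < w.length := by
  rcases w with _ | ⟨c, w⟩
  · simp at h
  · simp [mkB, len_flipF]

lemma mkA_inj (w : List Lt) (v v' : List Bool) (h : w.length = v.length + 3)
    (h' : w.length = v'.length + 3) (e : mkA w v = mkA w v') : v = v' := by
  rcases w with _ | ⟨c, w⟩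
  · simp at h
  · have := zipA_inj w _ _ (by simpa using h) (by simpa using h') e
    simpa using this

lemma mkB_inj (w : List Lt) (v v' : List Bool) (h : w.length = v.length + 3)
    (h' : w.length = v'.length + 3) (e : mkB w v = mkB w v') : v = v' := by
  rcases w with _ | ⟨c, w⟩
  · simp at h
  · have := zipB_inj w _ _ (by simpa using h) (by simpa using h') (flipF_inj e)
    simpa using this

lemma PQ_star (n m : List Lt) (hn : n ≠ []) (h1 : Pf n <:+ Pf m) (h2 : Qf n <:+ Qf m) : n = m := by
  have lP : ∀ w, (Pf w).length = w.length := fun w => by simp [Pf]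
  have lQ0 : ∀ w, (Qf0 w).length = w.length := fun w => by simp [Qf0]
  have lQ : ∀ w, (Qf w).length = w.length := fun w => by
    rcases w with _ | ⟨c, w⟩ <;> simp [Qf, Qf0, flipH]
  have hl : n.length ≤ m.length := by simpa [lP] using h1.length_le
  rcases hl.lt_or_eq with hl | hl
  · exfalso
    rw [List.suffix_iff_eq_drop, lP, lP] at h1
    rw [List.suffix_iff_eq_drop, lQ, lQ] at h2
    obtain ⟨d, hd⟩ : ∃ d, m.length - n.length = d + 1 := ⟨m.length - n.length - 1, by omega⟩
    rw [hd] at h1 h2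
    rcases m with _ | ⟨c, m⟩
    · simp at hl
    rcases n with _ | ⟨g, n⟩
    · exact hn rfl
    simp only [Pf, Qf, Qf0, flipH, List.map_cons, List.drop_succ_cons, ← List.map_drop] at h1 h2
    rcases hm : m.drop d with _ | ⟨k, l⟩
    · rw [hm] at h1; simp at h1
    · rw [hm] at h1 h2
      simp only [List.map_cons, List.cons.injEq, Prod.mk.injEq] at h1 h2
      have e1 := h1.1.1
      have e2 := h2.1.1
      rw [e1] at e2
      simp at e2
  · have e1 : Pf n = Pf m := h1.eq_of_length (by rw [lP, lP, hl])
    have e2 : Qf n = Qf m := h2.eq_of_length (by rw [lQ, lQ, hl])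
    have e3 : Qf0 n = Qf0 m := by
      rcases n with _ | ⟨c, n⟩ <;> rcases m with _ | ⟨d, m⟩ <;>
        simp [Qf, Qf0, flipH] at e2 ⊢
      exact e2
    clear h1 h2 e2 hn
    induction n generalizing m with
    | nil => simp at hl; exact (List.length_eq_zero_iff.1 hl.symm).symm
    | cons c n ih =>
      rcases m with _ | ⟨d, m⟩
      · simp at hl
      simp only [Pf, Qf0, List.map_cons, List.cons.injEq, Prod.mk.injEq] at e1 e3
      rw [ih m (by simpa using hl.le) (by simpa using hl) e1.2 e3.2]
      congr 1
      exact Prod.ext e1.1.1 (Prod.ext e1.1.2 e3.1.2)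

def DD (n : ℕ) : ℕ := 2 ^ ((dec n).length - 3) / 3

lemma exists_emb (n : ℕ) : ∃ g : Fin 3 × Fin (DD n) → List Bool, Function.Injective g ∧
    ∀ j, (dec n).length = (g j).length + 3 := by
  by_cases h : 3 ≤ (dec n).length
  · obtain ⟨f⟩ : Nonempty (Fin 3 × Fin (DD n) ↪ (Fin ((dec n).length - 3) → Bool)) := by
      rw [Function.Embedding.nonempty_iff_card_le]
      simp only [Fintype.card_prod, Fintype.card_fin, Fintype.card_pi, Fintype.card_bool,
        Finset.prod_const, Finset.card_univ]
      unfold DD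
      omega
    refine ⟨fun j => List.ofFn (f j), fun j j' e => f.injective (List.ofFn_injective e), fun j => ?_⟩
    simp; omega
  · have : DD n = 0 := by
      unfold DD
      rw [Nat.sub_eq_zero_of_le (by omega)]; norm_num
    refine ⟨fun j => [], fun j => ?_, fun j => ?_⟩ <;> (exfalso; have := j.2.2; omega)

def gE (n : ℕ) := (exists_emb n).choose
lemma gE_inj (n : ℕ) : Function.Injective (gE n) := (exists_emb n).choose_spec.1
lemma gE_len (n : ℕ) (j) : (dec n).length = (gE n j).length + 3 := (exists_emb n).choose_spec.2 j

lemma DD_growth (K : ℕ) : ∃ N : ℕ, ∀ n ≥ N, K * Nat.log 2 n ≤ DD n := by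
  have h1 : ∃ L : ℕ, ∀ l ≥ L, K * (3 * l + 1) ≤ 2 ^ (l - 3) / 3 := by
    have := (tendsto_pow_const_div_const_pow_of_one_lt 1 (r := (2:ℝ)) (by norm_num))
    have h2 := this.eventually (gt_mem_nhds (show (0:ℝ) < 1 / (4 * 24 * (K + 1)) by positivity))
    obtain ⟨L, hL⟩ := Filter.eventually_atTop.1 h2
    refine ⟨max L 3, fun l hl => ?_⟩
    have h3 := hL l (le_trans (le_max_left _ _) hl)
    have hl3 : 3 ≤ l := le_trans (le_max_right _ _) hl
    rw [Nat.le_div_iff_mul_le (by norm_num)]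
    rw [pow_one, div_lt_div_iff₀ (by positivity) (by positivity)] at h3
    obtain ⟨i, rfl⟩ := Nat.exists_eq_add_of_le' hl3
    simp only [Nat.add_sub_cancel]
    have h4 : (((i + 3) * (4 * 24 * (K + 1)) : ℕ) : ℝ) < ((2 ^ (i + 3) : ℕ) : ℝ) := by
      push_cast at h3 ⊢; linarith
    have h5 : (i + 3) * (4 * 24 * (K + 1)) < 2 ^ (i + 3) := by exact_mod_cast h4
    rw [pow_add] at h5
    nlinarith
  obtain ⟨L, hL⟩ := h1
  refine ⟨2 * 8 ^ L, fun n hn => ?_⟩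
  have hlen : L ≤ (dec n).length := by
    by_contra hc
    have h2 := le_pow_len n
    have : (8:ℕ) ^ (dec n).length ≤ 8 ^ L := Nat.pow_le_pow_right (by norm_num) (by omega)
    omega
  refine le_trans (Nat.mul_le_mul_left _ ?_) (hL _ hlen)
  have h2 := le_pow_len n
  have h3 : n ≤ 2 ^ (3 * (dec n).length + 1) := by
    rw [pow_succ, pow_mul]; norm_num; omega
  calc Nat.log 2 n ≤ Nat.log 2 (2 ^ (3 * (dec n).length + 1)) := Nat.log_mono_right h3
    _ = _ := Nat.log_pow (by norm_num) _

def sysX : Sys where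
  D := DD
  a n j := code (mkA (dec n) (gE n j))
  b n j := code (mkB (dec n) (gE n j))
  a_inj n j j' e := gE_inj n <| mkA_inj _ _ _ (gE_len n j) (gE_len n j') (by
    have := congrArg dec e; simpa [dec_code] using this)
  b_inj n j j' e := gE_inj n <| mkB_inj _ _ _ (gE_len n j) (gE_len n j') (by
    have := congrArg dec e; simpa [dec_code] using this)
  a_lt n j := code_lt _ _ (len_mkA _ _ (gE_len n j))
  b_lt n j := code_lt _ _ (len_mkB _ _ (gE_len n j))
  VS n := {m | dec n ≠ [] ∧ Pf (dec n) <:+ pw (dec m)}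
  VT n := {m | dec n ≠ [] ∧ Qf (dec n) <:+ qw (dec m)}
  a_mem n j := by
    refine ⟨fun h => ?_, ?_⟩
    · have := gE_len n j; rw [h] at this; simp at this
    · rw [dec_code, pw_mkA _ _ (gE_len n j)]
  b_mem n j := by
    refine ⟨fun h => ?_, ?_⟩
    · have := gE_len n j; rw [h] at this; simp at this
    · rw [dec_code, qw_mkB _ _ (gE_len n j)]
  VS_up n m j _ h := by
    refine ⟨h.1, ?_⟩
    have h2 := h.2
    rw [dec_code, pw_mkA _ _ (gE_len m j)] at h2
    exact h2.trans (List.suffix_cons _ _)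
  VT_up n m j _ h := by
    refine ⟨h.1, ?_⟩
    have h2 := h.2
    rw [dec_code, qw_mkB _ _ (gE_len m j)] at h2
    exact h2.trans (List.suffix_cons _ _)
  star n m j j' hnm h h' := by
    have h1 := h.2
    have h2 := h'.2
    rw [dec_code, pw_mkA _ _ (gE_len m j)] at h1
    rw [dec_code, qw_mkB _ _ (gE_len m j')] at h2
    exact hnm.ne (dec_inj (PQ_star _ _ h.1 h1 h2))
  growth := DD_growth
end APx

namespace APx

abbrev Z2 := ZMod 2
abbrev Om := ℕ → Z2

lemma two_Z2 : (2 : Z2) = 0 := by decide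
lemma Z2_add_self (x : Z2) : x + x = 0 := CharTwo.add_self_eq_zero x

/-- vanishing from `k` on -/
def Van (k : ℕ) (s : Om) : Prop := ∀ m, k ≤ m → s m = 0
/-- equality of bits below `n` -/
def EqB (n : ℕ) (s t : Om) : Prop := ∀ m, m < n → s m = t m

lemma EqB.symm {n s t} (h : EqB n s t) : EqB n t s := fun m hm => (h m hm).symm
lemma EqB.trans {n s t u} (h : EqB n s t) (h' : EqB n t u) : EqB n s u :=
  fun m hm => (h m hm).trans (h' m hm)
lemma EqB.mono {n n' s t} (h : EqB n s t) (hn : n' ≤ n) : EqB n' s t :=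
  fun m hm => h m (hm.trans_le hn)

namespace Sys
variable (S : Sys)

def swap : Sys where
  D := S.D
  a := S.b
  b := S.a
  a_inj := S.b_inj
  b_inj := S.a_inj
  a_lt := S.b_lt
  b_lt := S.a_lt
  VS := S.VT
  VT := S.VS
  a_mem := S.b_mem
  b_mem := S.a_mem
  VS_up := S.VT_up
  VT_up := S.VS_up
  star n m j j' h h1 h2 := S.star n m j' j h h2 h1
  growth := S.growth

def bil (m : ℕ) (i : Fin 3) (s t : Om) : Z2 := ∑ l : Fin (S.D m), s (S.a m (i, l)) * t (S.b m (i, l))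

lemma bil_swap (m i s t) : S.swap.bil m i t s = S.bil m i s t := by
  unfold bil
  exact Finset.sum_congr rfl fun l _ => mul_comm _ _

lemma bil_add_left (m i s s' t) : S.bil m i (s + s') t = S.bil m i s t + S.bil m i s' t := by
  simp [bil, add_mul, Finset.sum_add_distrib]
lemma bil_add_right (m i s t t') : S.bil m i s (t + t') = S.bil m i s t + S.bil m i s t' := by
  simp [bil, mul_add, Finset.sum_add_distrib]

lemma bil_congr {m i s s' t t'} (h : EqB m s s') (h' : EqB m t t') :
    S.bil m i s t = S.bil m i s' t' := by
  unfold bil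
  refine Finset.sum_congr rfl fun l _ => ?_
  rw [h _ (S.a_lt _ _), h' _ (S.b_lt _ _)]

def Rel (n k : ℕ) (s t : Om) : Prop := ∀ m, n ≤ m → m < k → t m = s m + S.bil m 0 s t

lemma Rel_swap {n k s t} : S.swap.Rel n k t s ↔ S.Rel n k s t := by
  unfold Rel
  refine forall_congr' fun m => forall_congr' fun _ => forall_congr' fun _ => ?_
  rw [bil_swap]
  constructor
  · intro h; linear_combination (-1 : Z2) * h + (-(S.bil m 0 s t)) * two_Z2
  · intro h; linear_combination (-1 : Z2) * h + (-(S.bil m 0 s t)) * two_Z2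

def tsol (n k : ℕ) (b s : Om) (m : ℕ) : Z2 :=
  if m < n then b m else if m < k then
    s m + ∑ l : Fin (S.D m), s (S.a m (0, l)) * tsol n k b s (S.b m (0, l)) else 0
termination_by m
decreasing_by exact S.b_lt _ _

lemma tsol_lo (n k b s) : EqB n (S.tsol n k b s) b := by
  intro m h
  rw [tsol, if_pos h]

lemma tsol_van {n k b s} (hnk : n ≤ k) : Van k (S.tsol n k b s) := by
  intro m h
  rw [tsol, if_neg (by omega), if_neg (by omega)]

lemma tsol_rel (n k b s) : S.Rel n k s (S.tsol n k b s) := by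
  intro m h1 h2
  rw [tsol, if_neg (by omega), if_pos h2]
  rfl

lemma tsol_unique {n k b s t} (hnk : n ≤ k) (h1 : S.Rel n k s t) (h2 : EqB n t b) (h3 : Van k t) :
    S.tsol n k b s = t := by
  funext m
  induction m using Nat.strong_induction_on with
  | _ m ih =>
    by_cases hn : m < n
    · rw [tsol_lo _ _ _ _ _ _ hn, h2 _ hn]
    by_cases hk : m < k
    · rw [S.tsol_rel n k b s m (by omega) hk, h1 m (by omega) hk]
      congr 1
      exact S.bil_congr (fun _ _ => rfl) ih
    · rw [S.tsol_van hnk m (by omega), h3 m (by omega)]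

lemma tsol_congr {n k b b' s} (hnk : n ≤ k) (h : EqB n b b') :
    S.tsol n k b s = S.tsol n k b' s :=
  S.tsol_unique hnk (S.tsol_rel _ _ _ _) ((S.tsol_lo _ _ _ _).trans h.symm) (S.tsol_van hnk)

/-- `Rel n k` from `Rel (n+1) k` and bit `n` -/
lemma tsol_succ {n k b s} (hnk : n < k) (h : b n = s n + S.bil n 0 s b) :
    S.tsol n k b s = S.tsol (n + 1) k b s := by
  refine S.tsol_unique hnk.le (fun m h1 h2 => ?_) ((S.tsol_lo _ _ _ _).mono (by omega)) (S.tsol_van hnk)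
  rcases h1.eq_or_lt with rfl | h1
  · rw [S.tsol_lo _ _ _ _ _ (by omega), h]
    congr 1
    exact S.bil_congr (fun _ _ => rfl) ((S.tsol_lo _ _ _ _).symm.mono (by omega))
  · exact S.tsol_rel _ _ _ _ m h1 h2

abbrev J (n : ℕ) := Fin 3 × Fin (S.D n) → Z2

def shA (n : ℕ) (p : S.J n) (s : Om) : Om := s + Function.extend (S.a n) p 0

lemma ext_a (n p j) : (Function.extend (S.a n) p (0 : Om)) (S.a n j) = p j :=
  (S.a_inj n).extend_apply _ _ _

lemma ext_ne {n p m} (h : (Function.extend (S.a n) p (0 : Om)) m ≠ 0) : ∃ j, S.a n j = m := by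
  by_contra hc
  rw [Function.extend_apply' _ _ _ hc] at h
  exact h rfl

lemma shA_a (n p s j) : S.shA n p s (S.a n j) = s (S.a n j) + p j := by
  simp [shA, ext_a]

lemma shA_ge {n p s m} (h : n ≤ m) : S.shA n p s m = s m := by
  have : (Function.extend (S.a n) p (0 : Om)) m = 0 := by
    by_contra hc
    obtain ⟨j, hj⟩ := S.ext_ne hc
    have := S.a_lt n j
    omega
  simp [shA, this]

lemma shA_invol (n p s) : S.shA n p (S.shA n p s) = s := by
  funext m
  simp only [shA, Pi.add_apply, add_assoc, Z2_add_self, add_zero]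

lemma shA_congr {n p s s' k} (h : EqB k s s') : EqB k (S.shA n p s) (S.shA n p s') := by
  intro m hm
  simp [shA, h m hm]

lemma shA_inj {n p p' s} (h : EqB n (S.shA n p s) (S.shA n p' s)) : p = p' := by
  funext j
  have := h _ (S.a_lt n j)
  rw [shA_a, shA_a] at this
  exact add_left_cancel this

/-- moved `t` -/
def mvT (n k : ℕ) (q : S.J n) (s t : Om) : Om := S.tsol (n + 1) k (S.swap.shA n q t) s
/-- moved `s` -/
def mvS (n k : ℕ) (p : S.J n) (s t : Om) : Om := S.swap.mvT n k p t s

section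
variable {n k : ℕ} {s t : Om}

lemma mvT_rel (q : S.J n) : S.Rel (n + 1) k s (S.mvT n k q s t) := S.tsol_rel _ _ _ _
lemma mvT_lo (q : S.J n) : EqB (n + 1) (S.mvT n k q s t) (S.swap.shA n q t) := S.tsol_lo _ _ _ _
lemma mvT_van (hnk : n < k) (q : S.J n) : Van k (S.mvT n k q s t) := S.tsol_van hnk
lemma mvS_rel (p : S.J n) : S.Rel (n + 1) k (S.mvS n k p s t) t :=
  S.Rel_swap.1 (S.swap.mvT_rel p)
lemma mvS_lo (p : S.J n) : EqB (n + 1) (S.mvS n k p s t) (S.shA n p s) := S.swap.mvT_lo p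
lemma mvS_van (hnk : n < k) (p : S.J n) : Van k (S.mvS n k p s t) := S.swap.mvT_van hnk p

lemma mvT_spec (hnk : n < k) (q : S.J n) (hr : S.Rel (n + 1) k s t) (ht : Van k t) :
    ∃ τ : Om, S.mvT n k q s t = t + τ ∧ (∀ m, τ m ≠ 0 → m ∈ S.VT n) ∧
      (∀ m, n < m → m < k → τ m = S.bil m 0 s τ) ∧
      (∀ m, n < m → τ m ≠ 0 → ∃ j, S.b m j ∈ S.VT n) := by
  set u := S.mvT n k q s t with hu
  have h3 : ∀ m, n < m → m < k → (u + t) m = S.bil m 0 s (u + t) := by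
    intro m h1 h2
    have e1 := S.mvT_rel (k := k) (s := s) (t := t) q m h1 h2
    have e2 := hr m h1 h2
    rw [bil_add_right, Pi.add_apply, ← hu] at *
    linear_combination e1 + e2 + s m * two_Z2
  have hvan : Van k (u + t) := fun m hm => by
    rw [Pi.add_apply, ht m hm, hu, S.mvT_van hnk q m hm, add_zero]
  have h2 : ∀ m, (u + t) m ≠ 0 → m ∈ S.VT n := by
    intro m
    induction m using Nat.strong_induction_on with
    | _ m ih =>
      intro hm
      by_cases h1 : m < n + 1
      · have e := S.mvT_lo (k := k) (s := s) (t := t) q m h1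
        have e' : u m = t m + (Function.extend (S.swap.a n) q (0 : Om)) m := e
        rw [Pi.add_apply, e'] at hm
        have : (Function.extend (S.swap.a n) q (0 : Om)) m ≠ 0 := by
          intro h0; apply hm; rw [h0, add_zero, Z2_add_self]
        obtain ⟨j, hj⟩ := S.swap.ext_ne this
        rw [← hj]; exact S.b_mem n j
      · by_cases h4 : m < k
        · rw [h3 m (by omega) h4, bil] at hm
          obtain ⟨l, -, hl⟩ := Finset.exists_ne_zero_of_sum_ne_zero hm
          exact S.VT_up n m (0, l) (by omega) (ih _ (S.b_lt _ _) (right_ne_zero_of_mul hl))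
        · exact absurd (hvan m (by omega)) hm
  refine ⟨u + t, ?_, h2, h3, ?_⟩
  · funext m
    simp only [Pi.add_apply]
    linear_combination -t m * two_Z2
  · intro m h1 hm
    have h4 : m < k := by
      by_contra hc; exact hm (hvan m (by omega))
    rw [h3 m h1 h4, bil] at hm
    obtain ⟨l, -, hl⟩ := Finset.exists_ne_zero_of_sum_ne_zero hm
    exact ⟨_, h2 _ (right_ne_zero_of_mul hl)⟩

lemma mvS_spec (hnk : n < k) (p : S.J n) (hr : S.Rel (n + 1) k s t) (hs : Van k s) :
    ∃ σ : Om, S.mvS n k p s t = s + σ ∧ (∀ m, σ m ≠ 0 → m ∈ S.VS n) ∧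
      (∀ m, n < m → m < k → σ m = S.bil m 0 σ t) ∧
      (∀ m, n < m → σ m ≠ 0 → ∃ j, S.a m j ∈ S.VS n) := by
  obtain ⟨σ, h1, h2, h3, h4⟩ := S.swap.mvT_spec hnk p (S.Rel_swap.2 hr) hs
  refine ⟨σ, h1, h2, fun m hm hk => ?_, h4⟩
  rw [h3 m hm hk, bil_swap]

lemma bil_cross {σ τ : Om} (hσ : ∀ m, σ m ≠ 0 → m ∈ S.VS n) (hτ : ∀ m, τ m ≠ 0 → m ∈ S.VT n)
    {m : ℕ} (hm : n < m) (i : Fin 3) : S.bil m i σ τ = 0 := by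
  unfold bil
  refine Finset.sum_eq_zero fun l _ => ?_
  by_contra hc
  exact S.star n m _ _ hm (hσ _ (left_ne_zero_of_mul hc)) (hτ _ (right_ne_zero_of_mul hc))

lemma mv_rel (hnk : n < k) (p q : S.J n) (hr : S.Rel (n + 1) k s t) (hs : Van k s) (ht : Van k t) :
    S.Rel (n + 1) k (S.mvS n k p s t) (S.mvT n k q s t) := by
  obtain ⟨σ, s1, s2, s3, s4⟩ := S.mvS_spec hnk p hr hs
  obtain ⟨τ, t1, t2, t3, t4⟩ := S.mvT_spec hnk q hr ht
  rw [s1, t1]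
  intro m h1 h2
  have e := hr m h1 h2
  have e1 := s3 m h1 h2
  have e2 := t3 m h1 h2
  have e3 := S.bil_cross s2 t2 h1 0
  simp only [bil_add_left, bil_add_right, Pi.add_apply]
  linear_combination e + e2 - e3 + e1 - σ m * two_Z2

lemma mvS_mv (hnk : n < k) (p q : S.J n) (hs : Van k s) :
    S.mvS n k p (S.mvS n k p s t) (S.mvT n k q s t) = s := by
  refine S.swap.tsol_unique hnk (S.Rel_swap.2 (S.mvT_rel q)) ?_ hs
  have h := S.shA_congr (n := n) (p := p) (S.mvS_lo (k := k) (s := s) (t := t) p)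
  rw [shA_invol] at h
  exact h.symm

lemma mvT_mv (hnk : n < k) (p q : S.J n) (ht : Van k t) :
    S.mvT n k q (S.mvS n k p s t) (S.mvT n k q s t) = t :=
  S.swap.mvS_mv hnk q p ht

/-- exponent of the sign -/
def E (n k : ℕ) (s t : Om) : Z2 := ∑ m ∈ Finset.Ico n k, s m * S.bil m 1 s t + S.bil k 2 s t

lemma E_split (hnk : n < k) (p q : S.J n) (hr : S.Rel (n + 1) k s t) (hs : Van k s) (ht : Van k t) :
    S.E (n + 1) k (S.mvS n k p s t) (S.mvT n k q s t) =
      S.E (n + 1) k (S.mvS n k p s t) t + S.E (n + 1) k s (S.mvT n k q s t) + S.E (n + 1) k s t := by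
  obtain ⟨σ, s1, s2, s3, s4⟩ := S.mvS_spec hnk p hr hs
  obtain ⟨τ, t1, t2, t3, t4⟩ := S.mvT_spec hnk q hr ht
  rw [s1, t1]
  unfold E
  have key : ∀ m ∈ Finset.Ico (n + 1) k, (s + σ) m * S.bil m 1 (s + σ) (t + τ) =
      (s + σ) m * S.bil m 1 (s + σ) t + s m * S.bil m 1 s (t + τ) + s m * S.bil m 1 s t := by
    intro m hm
    have hm1 : n < m := (Finset.mem_Ico.1 hm).1
    have e3 := S.bil_cross s2 t2 hm1 1
    have e4 : σ m * S.bil m 1 s τ = 0 := by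
      by_contra hc
      obtain ⟨j, hj⟩ := s4 m hm1 (left_ne_zero_of_mul hc)
      have h0 := right_ne_zero_of_mul hc
      unfold bil at h0
      obtain ⟨l, -, hl⟩ := Finset.exists_ne_zero_of_sum_ne_zero h0
      exact S.star n m _ _ hm1 hj (t2 _ (right_ne_zero_of_mul hl))
    simp only [bil_add_left, bil_add_right, Pi.add_apply]
    linear_combination (s m + σ m) * e3 + e4 - s m * S.bil m 1 s t * two_Z2
  rw [Finset.sum_congr rfl key, Finset.sum_add_distrib, Finset.sum_add_distrib]
  have e3 := S.bil_cross s2 t2 hnk 2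
  simp only [bil_add_left, bil_add_right]
  linear_combination e3 - S.bil k 2 s t * two_Z2

end

end Sys
end APx

namespace APx

section NB
variable {𝕜 : Type*} [RCLike 𝕜]

/-- character of `ZMod 2` -/
def sg (𝕜 : Type*) [RCLike 𝕜] (x : Z2) : 𝕜 := if x = 0 then 1 else -1

lemma sg_zero : sg 𝕜 0 = 1 := by simp [sg]
lemma sg_one : sg 𝕜 1 = -1 := by simp [sg]
lemma sg_add (x y : Z2) : sg 𝕜 (x + y) = sg 𝕜 x * sg 𝕜 y := by
  have h : ∀ x : Z2, x = 0 ∨ x = 1 := by decide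
  have h11 : (1 : Z2) + 1 = 0 := by decide
  rcases h x with rfl | rfl <;> rcases h y with rfl | rfl <;> simp [sg, h11]
lemma sg_norm (x : Z2) : ‖sg 𝕜 x‖ = 1 := by
  unfold sg
  split_ifs <;> simp
lemma sg_mul_self (x : Z2) : sg 𝕜 x * sg 𝕜 x = 1 := by
  rw [← sg_add, Z2_add_self, sg_zero]

variable {P Q : ℝ}

/-- the `P → Q` norm of a matrix is at most `C` -/
def NB (P Q : ℝ) {A B : Type*} [Fintype A] [Fintype B] (M : A → B → 𝕜) (C : ℝ) : Prop :=
  ∀ f : B → 𝕜, ∑ a, ‖∑ b, M a b * f b‖ ^ Q ≤ C ^ Q * (∑ b, ‖f b‖ ^ P) ^ (Q / P)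

lemma NB.reindex {A B A' B' : Type*} [Fintype A] [Fintype B] [Fintype A'] [Fintype B']
    {M : A → B → 𝕜} {C : ℝ} (h : NB P Q M C) (e : A' ≃ A) (e' : B' ≃ B) :
    NB P Q (fun a b => M (e a) (e' b)) C := by
  intro f
  have := h (fun b => f (e'.symm b))
  rw [← e.sum_comp, ← e'.sum_comp (fun b => ‖f (e'.symm b)‖ ^ P)] at this
  simp only [Equiv.symm_apply_apply] at this
  refine le_trans (le_of_eq ?_) this
  refine Finset.sum_congr rfl fun a _ => ?_
  rw [← e'.sum_comp (fun b => M (e a) b * f (e'.symm b))]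
  simp

lemma Lp_sum_le {A B : Type*} [Fintype A] (r : ℝ) (hr : 1 ≤ r) (s : Finset B) (h : B → A → ℝ)
    (hh : ∀ b a, 0 ≤ h b a) :
    (∑ a, (∑ b ∈ s, h b a) ^ r) ^ (1 / r) ≤ ∑ b ∈ s, (∑ a, (h b a) ^ r) ^ (1 / r) := by
  classical
  induction s using Finset.induction_on with
  | empty =>
    have hr0 : r ≠ 0 := by linarith
    simp [Real.zero_rpow hr0, hr0]
  | insert b s hb ih =>
    simp only [Finset.sum_insert hb]
    exact (Real.Lp_add_le_of_nonneg Finset.univ hr (fun a _ => hh b a)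
      (fun a _ => Finset.sum_nonneg fun b _ => hh b a)).trans (by gcongr)

lemma sum_rpow_le {B : Type*} (r : ℝ) (hr : 1 ≤ r) (s : Finset B) (h : B → ℝ) (hh : ∀ b, 0 ≤ h b) :
    ∑ b ∈ s, h b ^ r ≤ (∑ b ∈ s, h b) ^ r := by
  classical
  induction s using Finset.induction_on with
  | empty => simp [Real.zero_rpow (by linarith : r ≠ 0)]
  | insert b s hb ih =>
    simp only [Finset.sum_insert hb]
    exact le_trans (by gcongr) (Real.add_rpow_le_rpow_add (hh b) (Finset.sum_nonneg fun b _ => hh b) hr)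

lemma NB.tensor {A B A' B' : Type*} [Fintype A] [Fintype B] [Fintype A'] [Fintype B']
    (hP : 1 < P) (hPQ : P ≤ Q)
    {M : A → B → 𝕜} {C : ℝ} (h : NB P Q M C) {M' : A' → B' → 𝕜} {C' : ℝ} (h' : NB P Q M' C')
    (hC : 0 ≤ C) (hC' : 0 ≤ C') :
    NB P Q (fun (a : A × A') (b : B × B') => M a.1 b.1 * M' a.2 b.2) (C * C') := by
  intro f
  have hP0 : 0 < P := by linarith
  have hQ0 : 0 < Q := by linarith
  have hr : 1 ≤ Q / P := by rw [le_div_iff₀ hP0]; linarith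
  have hr0 : 0 < Q / P := by positivity
  set g : A' → B → 𝕜 := fun a' b => ∑ b', M' a' b' * f (b, b') with hg
  have e1 : ∑ a : A × A', ‖∑ b : B × B', M a.1 b.1 * M' a.2 b.2 * f b‖ ^ Q
      = ∑ a', ∑ a, ‖∑ b, M a b * g a' b‖ ^ Q := by
    rw [Fintype.sum_prod_type, Finset.sum_comm]
    refine Finset.sum_congr rfl fun a' _ => Finset.sum_congr rfl fun a _ => ?_
    rw [Fintype.sum_prod_type]
    simp only [hg, Finset.mul_sum, mul_assoc]
  rw [e1]
  have e2 : ∑ a', ∑ a, ‖∑ b, M a b * g a' b‖ ^ Q ≤ C ^ Q * ∑ a', (∑ b, ‖g a' b‖ ^ P) ^ (Q / P) := by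
    rw [Finset.mul_sum]
    exact Finset.sum_le_sum fun a' _ => h (g a')
  have e3 := Lp_sum_le (A := A') (Q / P) hr (Finset.univ : Finset B) (fun b a' => ‖g a' b‖ ^ P)
    (fun _ _ => by positivity)
  have e4 : ∀ b, (∑ a', (‖g a' b‖ ^ P) ^ (Q / P)) ^ (1 / (Q / P)) ≤ C' ^ P * ∑ b', ‖f (b, b')‖ ^ P := by
    intro b
    have := h' (fun b' => f (b, b'))
    have e5 : ∑ a', (‖g a' b‖ ^ P) ^ (Q / P) ≤ C' ^ Q * (∑ b', ‖f (b, b')‖ ^ P) ^ (Q / P) := by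
      refine le_trans (le_of_eq (Finset.sum_congr rfl fun a' _ => ?_)) this
      rw [← Real.rpow_mul (norm_nonneg _), mul_div_cancel₀ _ hP0.ne']
    have e6 : C' ^ Q * (∑ b', ‖f (b, b')‖ ^ P) ^ (Q / P) = (C' ^ P * ∑ b', ‖f (b, b')‖ ^ P) ^ (Q / P) := by
      rw [Real.mul_rpow (by positivity) (by positivity), ← Real.rpow_mul hC', mul_div_cancel₀ _ hP0.ne']
    rw [e6] at e5
    calc _ ≤ ((C' ^ P * ∑ b', ‖f (b, b')‖ ^ P) ^ (Q / P)) ^ (1 / (Q / P)) := by gcongr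
      _ = _ := by rw [← Real.rpow_mul (by positivity), mul_one_div_cancel hr0.ne', Real.rpow_one]
  have e7 : (∑ a', (∑ b, ‖g a' b‖ ^ P) ^ (Q / P)) ≤ (C' ^ P * ∑ b, ‖f b‖ ^ P) ^ (Q / P) := by
    have e8 := e3.trans (Finset.sum_le_sum fun b _ => e4 b)
    rw [← Finset.mul_sum, ← Fintype.sum_prod_type' (f := fun b b' => ‖f (b, b')‖ ^ P)] at e8
    calc (∑ a', (∑ b, ‖g a' b‖ ^ P) ^ (Q / P))
        = ((∑ a', (∑ b, ‖g a' b‖ ^ P) ^ (Q / P)) ^ (1 / (Q / P))) ^ (Q / P) := by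
          rw [← Real.rpow_mul (by positivity), one_div_mul_cancel hr0.ne', Real.rpow_one]
      _ ≤ _ := by gcongr
  calc _ ≤ _ := e2
    _ ≤ C ^ Q * (C' ^ P * ∑ b, ‖f b‖ ^ P) ^ (Q / P) := by gcongr
    _ = _ := by
      rw [Real.mul_rpow (by positivity) (by positivity), ← Real.rpow_mul hC', mul_div_cancel₀ _ hP0.ne',
        Real.mul_rpow hC hC', mul_assoc]

lemma NB.add {A B : Type*} [Fintype A] [Fintype B] (hP : 1 < P) (hPQ : P ≤ Q)
    {M M' : A → B → 𝕜} {C C' : ℝ} (h : NB P Q M C) (h' : NB P Q M' C') (hC : 0 ≤ C) (hC' : 0 ≤ C') :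
    NB P Q (fun a b => M a b + M' a b) (C + C') := by
  intro f
  have hP0 : 0 < P := by linarith
  have hQ0 : 0 < Q := by linarith
  have key : ∀ (M : A → B → 𝕜) (C : ℝ), 0 ≤ C → NB P Q M C →
      (∑ a, ‖∑ b, M a b * f b‖ ^ Q) ^ (1 / Q) ≤ C * (∑ b, ‖f b‖ ^ P) ^ (1 / P) := by
    intro M C hC h
    calc _ ≤ (C ^ Q * (∑ b, ‖f b‖ ^ P) ^ (Q / P)) ^ (1 / Q) := by gcongr; exact h f
      _ = _ := by
        rw [Real.mul_rpow (by positivity) (by positivity), ← Real.rpow_mul hC,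
          ← Real.rpow_mul (by positivity), mul_one_div_cancel hQ0.ne', Real.rpow_one]
        congr 2; field_simp
  have e1 := Real.Lp_add_le_of_nonneg (p := Q) (Finset.univ : Finset A) (by linarith)
    (f := fun a => ‖∑ b, M a b * f b‖) (g := fun a => ‖∑ b, M' a b * f b‖)
    (fun _ _ => norm_nonneg _) (fun _ _ => norm_nonneg _)
  have e2 := e1.trans (add_le_add (key M C hC h) (key M' C' hC' h'))
  rw [← add_mul] at e2
  have e3 : ∑ a, ‖∑ b, (M a b + M' a b) * f b‖ ^ Q ≤
      ∑ a, (‖∑ b, M a b * f b‖ + ‖∑ b, M' a b * f b‖) ^ Q := by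
    gcongr with a
    simp only [add_mul, Finset.sum_add_distrib]
    exact norm_add_le _ _
  calc _ ≤ _ := e3
    _ = ((∑ a, (‖∑ b, M a b * f b‖ + ‖∑ b, M' a b * f b‖) ^ Q) ^ (1 / Q)) ^ Q := by
      rw [← Real.rpow_mul (by positivity), one_div_mul_cancel hQ0.ne', Real.rpow_one]
    _ ≤ ((C + C') * (∑ b, ‖f b‖ ^ P) ^ (1 / P)) ^ Q := by gcongr
    _ = _ := by
      rw [Real.mul_rpow (by positivity) (by positivity), ← Real.rpow_mul (by positivity)]
      congr 2; field_simp

lemma NB.block {A B H X : Type*} [Fintype A] [Fintype B] [Fintype H] [Fintype X]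
    (hP : 1 < P) (hPQ : P ≤ Q) {K : H → X → X → 𝕜} {C : ℝ} (hC : 0 ≤ C) (hK : ∀ η, NB P Q (K η) C)
    (f : B → 𝕜) (y : A → 𝕜) (σ : H → X → A) (τ : H → X → B)
    (hσ : ∀ a, y a ≠ 0 → ∃ η p, σ η p = a)
    (hτ : ∀ η q η' q', τ η q = τ η' q' → η = η' ∧ q = q')
    (F G : H → X → 𝕜) (hF : ∀ η p, ‖F η p‖ = 1) (hG : ∀ η p, ‖G η p‖ = 1)
    (hy : ∀ η p, y (σ η p) = F η p * ∑ q, K η p q * (G η q * f (τ η q))) :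
    ∑ a, ‖y a‖ ^ Q ≤ C ^ Q * (∑ b, ‖f b‖ ^ P) ^ (Q / P) := by
  classical
  have hP0 : 0 < P := by linarith
  have hQ0 : 0 < Q := by linarith
  have hr : 1 ≤ Q / P := by rw [le_div_iff₀ hP0]; linarith
  have e1 : ∑ a, ‖y a‖ ^ Q ≤ ∑ η, ∑ p, ‖y (σ η p)‖ ^ Q := by
    rw [← Fintype.sum_prod_type' (f := fun η p => ‖y (σ η p)‖ ^ Q)]
    have : ∑ a, ‖y a‖ ^ Q = ∑ a ∈ Finset.univ.image (fun x : H × X => σ x.1 x.2), ‖y a‖ ^ Q := by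
      symm
      apply Finset.sum_subset (Finset.subset_univ _)
      intro a _ ha
      have : y a = 0 := by
        by_contra hc
        obtain ⟨η, p, h⟩ := hσ a hc
        exact ha (Finset.mem_image.2 ⟨(η, p), Finset.mem_univ _, h⟩)
      rw [this, norm_zero, Real.zero_rpow hQ0.ne']
    rw [this]
    exact Finset.sum_image_le_of_nonneg (fun _ _ => by positivity)
  have e2 : ∀ η, ∑ p, ‖y (σ η p)‖ ^ Q ≤ C ^ Q * (∑ q, ‖f (τ η q)‖ ^ P) ^ (Q / P) := by
    intro η
    have := hK η (fun q => G η q * f (τ η q))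
    simp only [norm_mul, hG, one_mul] at this
    refine le_trans (le_of_eq (Finset.sum_congr rfl fun p _ => ?_)) this
    rw [hy, norm_mul, hF, one_mul]
  calc _ ≤ _ := e1
    _ ≤ ∑ η, C ^ Q * (∑ q, ‖f (τ η q)‖ ^ P) ^ (Q / P) := Finset.sum_le_sum fun η _ => e2 η
    _ = C ^ Q * ∑ η, (∑ q, ‖f (τ η q)‖ ^ P) ^ (Q / P) := by rw [Finset.mul_sum]
    _ ≤ C ^ Q * (∑ η, ∑ q, ‖f (τ η q)‖ ^ P) ^ (Q / P) := by
      gcongr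
      exact sum_rpow_le _ hr _ _ fun η => by positivity
    _ ≤ C ^ Q * (∑ b, ‖f b‖ ^ P) ^ (Q / P) := by
      gcongr
      rw [← Fintype.sum_prod_type' (f := fun η q => ‖f (τ η q)‖ ^ P)]
      have hinj : Function.Injective (fun x : H × X => τ x.1 x.2) := fun x x' h => by
        obtain ⟨h1, h2⟩ := hτ _ _ _ _ h
        exact Prod.ext h1 h2
      rw [← Finset.sum_image (s := Finset.univ) (f := fun b => ‖f b‖ ^ P) (g := fun x : H × X => τ x.1 x.2)
        (fun a _ b _ h => hinj h)]
      exact Finset.sum_le_sum_of_subset_of_nonneg (Finset.subset_univ _) fun _ _ _ => by positivity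

def omg (P Q : ℝ) : ℝ := 2 ^ (1 / Q + (1 - 1 / P))

lemma omg_pos : 0 < omg P Q := by unfold omg; positivity

lemma add_le_Lp (hP : 1 < P) {x y : ℝ} (hx : 0 ≤ x) (hy : 0 ≤ y) :
    x + y ≤ 2 ^ (1 - 1 / P) * (x ^ P + y ^ P) ^ (1 / P) := by
  have hP0 : 0 < P := by linarith
  have h := Real.inner_le_Lp_mul_Lq_of_nonneg (Finset.univ : Finset (Fin 2)) (p := P) (q := P.conjExponent)
    (f := ![x, y]) (g := ![1, 1]) (Real.HolderConjugate.conjExponent hP)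
    (by intro i _; fin_cases i <;> simp [hx, hy]) (by intro i _; fin_cases i <;> simp)
  simp only [Fin.sum_univ_two] at h
  simp only [Matrix.cons_val_zero, Matrix.cons_val_one, mul_one, Real.one_rpow] at h
  refine h.trans (le_of_eq ?_)
  rw [mul_comm]
  congr 1
  rw [Real.conjExponent]
  have : P - 1 ≠ 0 := by linarith
  have h2 : (1 : ℝ) + 1 = 2 := by norm_num
  rw [h2]
  congr 1
  field_simp

lemma omg_pow (hP : 1 < P) (hPQ : P ≤ Q) (z : ℝ) (hz : 0 ≤ z) :
    omg P Q ^ Q * z ^ (Q / P) = 2 * (2 ^ (1 - 1 / P) * z ^ (1 / P)) ^ Q := by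
  have hP0 : 0 < P := by linarith
  have hQ0 : 0 < Q := by linarith
  rw [omg, Real.rpow_add (by norm_num), Real.mul_rpow (by positivity) (by positivity),
    ← Real.rpow_mul (by norm_num), one_div_mul_cancel hQ0.ne', Real.rpow_one,
    Real.mul_rpow (by positivity) (by positivity), ← Real.rpow_mul hz, mul_assoc]
  congr 4
  field_simp

lemma two_omg (hP : 1 < P) (hPQ : P ≤ Q) (u v : 𝕜) :
    ‖u + v‖ ^ Q + ‖u + v‖ ^ Q ≤ omg P Q ^ Q * (‖u‖ ^ P + ‖v‖ ^ P) ^ (Q / P) := by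
  rw [omg_pow hP hPQ _ (by positivity), ← two_mul]
  have := (norm_add_le u v).trans (add_le_Lp hP (norm_nonneg _) (norm_nonneg _))
  have hQ0 : 0 ≤ Q := by linarith
  gcongr

lemma exists_kap (𝕜 : Type*) [RCLike 𝕜] (hP : 1 < P) (hPQ : P ≤ Q) :
    ∃ κ : ℝ, 0 < κ ∧ κ < omg P Q ∧ ∀ u v : 𝕜,
    ‖u + v‖ ^ Q + ‖u - v‖ ^ Q ≤ κ ^ Q * (‖u‖ ^ P + ‖v‖ ^ P) ^ (Q / P) := by
  have hP0 : 0 < P := by linarith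
  have hQ0 : 0 < Q := by linarith
  set Sph : Set (𝕜 × 𝕜) := {z | ‖z.1‖ ^ P + ‖z.2‖ ^ P = 1} with hS
  set g : 𝕜 × 𝕜 → ℝ := fun z => ‖z.1 + z.2‖ ^ Q + ‖z.1 - z.2‖ ^ Q with hg
  have gc : Continuous g := by
    apply Continuous.add
    · exact (continuous_fst.add continuous_snd).norm.rpow_const (fun _ => Or.inr hQ0.le)
    · exact (continuous_fst.sub continuous_snd).norm.rpow_const (fun _ => Or.inr hQ0.le)
  have Sc : IsCompact Sph := by
    apply Metric.isCompact_of_isClosed_isBounded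
    · apply isClosed_eq _ continuous_const
      exact (continuous_fst.norm.rpow_const (fun _ => Or.inr hP0.le)).add
        (continuous_snd.norm.rpow_const (fun _ => Or.inr hP0.le))
    · refine (Metric.isBounded_closedBall (x := (0 : 𝕜 × 𝕜)) (r := 1)).subset fun z hz => ?_
      have hz' : ‖z.1‖ ^ P + ‖z.2‖ ^ P = 1 := hz
      rw [mem_closedBall_zero_iff, Prod.norm_def, max_le_iff]
      have h1 : 0 ≤ ‖z.1‖ ^ P := by positivity
      have h2 : 0 ≤ ‖z.2‖ ^ P := by positivity
      constructor
      · by_contra hc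
        have := Real.one_lt_rpow (not_le.1 hc) hP0
        linarith
      · by_contra hc
        have := Real.one_lt_rpow (not_le.1 hc) hP0
        linarith
  have S1 : ((1 : 𝕜), (0 : 𝕜)) ∈ Sph := by simp [hS, Real.zero_rpow hP0.ne']
  obtain ⟨z, hz, hmax⟩ := Sc.exists_isMaxOn ⟨_, S1⟩ gc.continuousOn
  have hz' : ‖z.1‖ ^ P + ‖z.2‖ ^ P = 1 := hz
  have gpos : 0 < g z := by
    have := hmax S1
    have h2 : g ((1 : 𝕜), (0 : 𝕜)) = 2 := by simp [hg]; norm_num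
    have h3 : g ((1 : 𝕜), (0 : 𝕜)) ≤ g z := this
    linarith
  have glt : g z < omg P Q ^ Q := by
    have h1 : ‖z.1‖ + ‖z.2‖ ≤ 2 ^ (1 - 1 / P) := by
      have := add_le_Lp hP (norm_nonneg z.1) (norm_nonneg z.2)
      rwa [hz', Real.one_rpow, mul_one] at this
    have h2 := omg_pow hP hPQ 1 zero_le_one
    rw [Real.one_rpow, Real.one_rpow, mul_one, mul_one] at h2
    rw [h2]
    have ha : ‖z.1 + z.2‖ ≤ 2 ^ (1 - 1 / P) := (norm_add_le _ _).trans h1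
    have hb : ‖z.1 - z.2‖ ≤ 2 ^ (1 - 1 / P) := (norm_sub_le _ _).trans h1
    have ha' : ‖z.1 + z.2‖ ^ Q ≤ ((2:ℝ) ^ (1 - 1 / P)) ^ Q := by gcongr
    have hb' : ‖z.1 - z.2‖ ^ Q ≤ ((2:ℝ) ^ (1 - 1 / P)) ^ Q := by gcongr
    by_contra hc
    have hc' : 2 * ((2:ℝ) ^ (1 - 1 / P)) ^ Q ≤ ‖z.1 + z.2‖ ^ Q + ‖z.1 - z.2‖ ^ Q := not_lt.1 hc
    have ea : (2:ℝ) ^ (1 - 1 / P) ≤ ‖z.1 + z.2‖ := by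
      rw [← Real.rpow_le_rpow_iff (by positivity) (by positivity) hQ0]; linarith
    have eb : (2:ℝ) ^ (1 - 1 / P) ≤ ‖z.1 - z.2‖ := by
      rw [← Real.rpow_le_rpow_iff (by positivity) (by positivity) hQ0]; linarith
    have par : ‖z.1 + z.2‖ * ‖z.1 + z.2‖ + ‖z.1 - z.2‖ * ‖z.1 - z.2‖ =
        2 * (‖z.1‖ * ‖z.1‖ + ‖z.2‖ * ‖z.2‖) := by
      have := parallelogram_law_with_norm 𝕜 z.1 z.2
      linarith
    have e1 : ‖z.1‖ + ‖z.2‖ ≤ ‖z.1 + z.2‖ := h1.trans ea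
    have e2 : ‖z.1‖ + ‖z.2‖ ≤ ‖z.1 - z.2‖ := h1.trans eb
    have n1 := norm_nonneg z.1
    have n2 := norm_nonneg z.2
    have e0 : ‖z.1‖ * ‖z.2‖ = 0 := by
      have := mul_nonneg n1 n2
      nlinarith
    have h3 : (1:ℝ) < 2 ^ (1 - 1 / P) := by
      apply Real.one_lt_rpow (by norm_num)
      have : 1 / P < 1 := by rw [div_lt_one hP0]; exact hP
      linarith
    have h4 : (2:ℝ) ^ (1 - 1 / P) ≤ ‖z.1‖ + ‖z.2‖ := ea.trans (norm_add_le _ _)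
    rcases mul_eq_zero.1 e0 with h0 | h0
    · rw [h0, Real.zero_rpow hP0.ne', zero_add] at hz'
      have : ‖z.2‖ = 1 := by
        rw [← Real.rpow_left_inj n2 zero_le_one hP0.ne', hz', Real.one_rpow]
      linarith
    · rw [h0, Real.zero_rpow hP0.ne', add_zero] at hz'
      have : ‖z.1‖ = 1 := by
        rw [← Real.rpow_left_inj n1 zero_le_one hP0.ne', hz', Real.one_rpow]
      linarith
  have gk : (g z ^ (1 / Q)) ^ Q = g z := by
    rw [← Real.rpow_mul gpos.le, one_div_mul_cancel hQ0.ne', Real.rpow_one]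
  refine ⟨g z ^ (1 / Q), by positivity, ?_, ?_⟩
  · rw [← Real.rpow_lt_rpow_iff (by positivity) omg_pos.le hQ0, gk]
    exact glt
  · intro u v
    rw [gk]
    set w := ‖u‖ ^ P + ‖v‖ ^ P with hw
    have hw0 : 0 ≤ w := by positivity
    rcases hw0.eq_or_lt with h0 | h0
    · have hu : ‖u‖ ^ P = 0 := by
        have h1 : 0 ≤ ‖u‖ ^ P := by positivity
        have h2 : 0 ≤ ‖v‖ ^ P := by positivity
        linarith
      have hv : ‖v‖ ^ P = 0 := by linarith
      rw [Real.rpow_eq_zero (norm_nonneg _) hP0.ne', norm_eq_zero] at hu hv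
      rw [hu, hv]; simp [Real.zero_rpow hQ0.ne']
      positivity
    · set c : ℝ := w ^ (1 / P) with hc
      have hcpos : 0 < c := by positivity
      have hcP : c ^ P = w := by
        rw [hc, ← Real.rpow_mul hw0, one_div_mul_cancel hP0.ne', Real.rpow_one]
      have hcQ : c ^ Q = w ^ (Q / P) := by
        rw [hc, ← Real.rpow_mul hw0]; congr 1; field_simp
      have nd : ∀ x : 𝕜, ‖x / (c : 𝕜)‖ = ‖x‖ / c := fun x => by
        rw [norm_div, RCLike.norm_ofReal, abs_of_pos hcpos]
      have hm : (u / (c : 𝕜), v / (c : 𝕜)) ∈ Sph := by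
        simp only [hS, Set.mem_ofPred_eq, nd]
        rw [Real.div_rpow (norm_nonneg _) hcpos.le, Real.div_rpow (norm_nonneg _) hcpos.le, hcP, ← add_div,
          ← hw, div_self h0.ne']
      have := hmax hm
      have h5 : g (u / (c : 𝕜), v / (c : 𝕜)) ≤ g z := this
      simp only [hg] at h5
      rw [← add_div, ← sub_div, nd, nd, Real.div_rpow (norm_nonneg _) hcpos.le,
        Real.div_rpow (norm_nonneg _) hcpos.le, ← add_div, div_le_iff₀ (by positivity), hcQ] at h5
      exact h5

open scoped Classical in
/-- the family of sign matrices -/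
lemma NB_sign (hP : 1 < P) (hPQ : P ≤ Q) {κ : ℝ} (hκ : 0 < κ) (hk : ∀ u v : 𝕜,
    ‖u + v‖ ^ Q + ‖u - v‖ ^ Q ≤ κ ^ Q * (‖u‖ ^ P + ‖v‖ ^ P) ^ (Q / P))
    (α : Type) [Fintype α] (lam : α → Z2) :
    NB P Q (fun p q : α → Z2 => sg 𝕜 (∑ j, lam j * (p j * q j))) (∏ j, if lam j = 0 then omg P Q else κ) := by
  have base : ∀ c : Z2, NB P Q (fun x y : Z2 => sg 𝕜 (c * (x * y))) (if c = 0 then omg P Q else κ) := by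
    intro c f
    have su : ∀ (h : Z2 → ℝ), ∑ x, h x = h 0 + h 1 := fun h => Fin.sum_univ_two h
    have su' : ∀ (h : Z2 → 𝕜), ∑ x, h x = h 0 + h 1 := fun h => Fin.sum_univ_two h
    by_cases hc : c = 0
    · subst hc
      simp only [su, su', zero_mul, sg_zero, one_mul, if_true]
      exact two_omg hP hPQ _ _
    · have hc1 : c = 1 := by
        revert hc; revert c; decide
      subst hc1
      simp only [su, su', mul_zero, mul_one, zero_mul, sg_zero, sg_one, one_mul, one_ne_zero, if_false, neg_mul,
        ← sub_eq_add_neg]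
      exact hk _ _
  have cpos : ∀ c : Z2, 0 ≤ (if c = 0 then omg P Q else κ) := fun c => by
    split_ifs
    · exact omg_pos.le
    · exact hκ.le
  revert lam
  refine Fintype.induction_empty_option (P := fun (α : Type) _ => ∀ lam : α → Z2,
    NB P Q (fun p q : α → Z2 => sg 𝕜 (∑ j, lam j * (p j * q j))) (∏ j, if lam j = 0 then omg P Q else κ))
    ?_ ?_ ?_ α
  · intro α β _ e h lam
    let _ : Fintype α := Fintype.ofEquiv β e.symm
    have := (h (fun j => lam (e j))).reindex (e.arrowCongr (Equiv.refl Z2)).symm (e.arrowCongr (Equiv.refl Z2)).symm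
    rw [← e.prod_comp]
    convert this using 4 with p q
    rw [← e.sum_comp]
    rfl
  · intro lam f
    simp only [Finset.univ_unique, Finset.sum_singleton, Finset.univ_eq_empty, Finset.sum_empty, sg_zero,
      one_mul, Finset.prod_empty, Real.one_rpow]
    rw [← Real.rpow_mul (norm_nonneg _), mul_div_cancel₀ _ (by linarith : P ≠ 0)]
  · intro α _ h lam
    have := ((base (lam none)).tensor hP hPQ (h fun j => lam (some j)) (cpos _)
      (Finset.prod_nonneg fun j _ => cpos _)).reindex (Equiv.piOptionEquivProd (β := fun _ : Option α => Z2))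
        (Equiv.piOptionEquivProd (β := fun _ : Option α => Z2))
    rw [Fintype.prod_option]
    convert this using 3 with p q
    rw [Fintype.sum_option, sg_add]
    rfl

end NB
end APx

namespace APx

section
variable {𝕜 : Type*} [RCLike 𝕜] {P Q : ℝ}

lemma NB.mono {A B : Type*} [Fintype A] [Fintype B] {M : A → B → 𝕜} {C C' : ℝ} (h : NB P Q M C)
    (hQ : 0 ≤ Q) (hC : 0 ≤ C) (hCC : C ≤ C') : NB P Q M C' := fun f =>
  (h f).trans (by gcongr)

lemma NB.unit {A B : Type*} [Fintype A] [Fintype B] {M : A → B → 𝕜} {C : ℝ} (h : NB P Q M C)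
    {c : 𝕜} (hc : ‖c‖ = 1) : NB P Q (fun a b => c * M a b) C := fun f => by
  refine le_trans (le_of_eq (Finset.sum_congr rfl fun a _ => ?_)) (h f)
  simp only [mul_assoc, ← Finset.mul_sum, norm_mul, hc, one_mul]

lemma NB.zero {A B : Type*} [Fintype A] [Fintype B] {C : ℝ} (hC : 0 ≤ C) (hQ : 0 < Q) :
    NB P Q (fun (_ : A) (_ : B) => (0 : 𝕜)) C := fun f => by
  simp only [zero_mul, Finset.sum_const_zero, norm_zero, Real.zero_rpow hQ.ne']
  positivity

lemma NB.blockM {A B H X : Type*} [Fintype A] [Fintype B] [Fintype H] [Fintype X]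
    (hP : 1 < P) (hPQ : P ≤ Q) {K : H → X → X → 𝕜} {C : ℝ} (hC : 0 ≤ C) (hK : ∀ η, NB P Q (K η) C)
    (M : A → B → 𝕜) (σ : H → X → A) (τ : H → X → B)
    (h1 : ∀ a b, M a b ≠ 0 → ∃ η p, σ η p = a)
    (h2 : ∀ η p b, M (σ η p) b ≠ 0 → ∃ q, τ η q = b)
    (hτ : ∀ η q η' q', τ η q = τ η' q' → η = η' ∧ q = q')
    (F G : H → X → 𝕜) (hF : ∀ η p, ‖F η p‖ = 1) (hG : ∀ η p, ‖G η p‖ = 1)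
    (hy : ∀ η p q, M (σ η p) (τ η q) = F η p * K η p q * G η q) :
    NB P Q M C := by
  classical
  intro f
  refine NB.block hP hPQ hC hK f (fun a => ∑ b, M a b * f b) σ τ ?_ hτ F G hF hG ?_
  · intro a ha
    obtain ⟨b, -, hb⟩ := Finset.exists_ne_zero_of_sum_ne_zero ha
    exact h1 a b (left_ne_zero_of_mul hb)
  · intro η p
    have : ∑ b, M (σ η p) b * f b = ∑ b ∈ Finset.univ.image (τ η), M (σ η p) b * f b := by
      symm
      apply Finset.sum_subset (Finset.subset_univ _)
      intro b _ hb
      have : M (σ η p) b = 0 := by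
        by_contra hc
        obtain ⟨q, h⟩ := h2 η p b hc
        exact hb (Finset.mem_image.2 ⟨q, Finset.mem_univ _, h⟩)
      rw [this, zero_mul]
    rw [this, Finset.sum_image (fun x _ y _ h => (hτ _ _ _ _ h).2), Finset.mul_sum]
    refine Finset.sum_congr rfl fun q _ => ?_
    rw [hy]; ring
end

/-- finite bit vectors -/
def V (k : ℕ) := {s : Om // Van k s}

def VEquiv (k : ℕ) : V k ≃ (Fin k → Z2) where
  toFun s i := s.1 i
  invFun f := ⟨fun m => if h : m < k then f ⟨m, h⟩ else 0, fun m hm => dif_neg (by omega)⟩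
  left_inv s := by
    apply Subtype.ext; funext m
    by_cases h : m < k
    · simp [h]
    · simp only [dif_neg h]; exact (s.2 m (by omega)).symm
  right_inv f := by funext i; simp

instance (k : ℕ) : Fintype (V k) := Fintype.ofEquiv _ (VEquiv k).symm

lemma card_V (k : ℕ) : Fintype.card (V k) = 2 ^ k := by
  rw [Fintype.card_congr (VEquiv k)]
  simp [ZMod.card]

def tr (k : ℕ) (s : Om) : V k := ⟨fun m => if m < k then s m else 0, fun m hm => if_neg (by omega)⟩

lemma tr_eq (k : ℕ) (s : Om) : EqB k (tr k s).1 s := fun m hm => if_pos hm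

lemma V_ext {k : ℕ} {s t : V k} (h : EqB k s.1 t.1) : s = t := by
  apply Subtype.ext; funext m
  by_cases hm : m < k
  · exact h m hm
  · rw [s.2 m (by omega), t.2 m (by omega)]

abbrev IX := Σ k, V k

section op
variable {𝕜 : Type*} [RCLike 𝕜] {p q : ℝ≥0∞} [Fact (1 ≤ p)] [Fact (1 ≤ q)]

lemma lp_le_of_blocks (hp : 1 < p) (hpq : p ≤ q) (hq : q < ⊤) (f : lp (fun _ : IX => 𝕜) p) (y : IX → 𝕜) (C : ℝ)
    (hC : 0 ≤ C)
    (h : ∀ k, ∑ s : V k, ‖y ⟨k, s⟩‖ ^ q.toReal ≤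
      C ^ q.toReal * (∑ t : V k, ‖f ⟨k, t⟩‖ ^ p.toReal) ^ (q.toReal / p.toReal)) (F : Finset IX) :
    ∑ i ∈ F, ‖y i‖ ^ q.toReal ≤ (C * ‖f‖) ^ q.toReal := by
  classical
  have hpt : p ≠ ⊤ := (hpq.trans_lt hq).ne
  have hP : 1 < p.toReal := by
    rw [← ENNReal.toReal_one]; exact (ENNReal.toReal_lt_toReal (by simp) hpt).2 hp
  have hPQ : p.toReal ≤ q.toReal := (ENNReal.toReal_le_toReal hpt hq.ne).2 hpq
  have hP0 : 0 < p.toReal := by linarith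
  have hQ0 : 0 < q.toReal := by linarith
  have hr : 1 ≤ q.toReal / p.toReal := by rw [le_div_iff₀ hP0]; linarith
  set K : Finset ℕ := F.image Sigma.fst
  have hsub : F ⊆ K.sigma (fun _ => Finset.univ) := fun i hi =>
    Finset.mem_sigma.2 ⟨Finset.mem_image_of_mem _ hi, Finset.mem_univ _⟩
  calc _ ≤ ∑ i ∈ K.sigma (fun _ => Finset.univ), ‖y i‖ ^ q.toReal :=
        Finset.sum_le_sum_of_subset_of_nonneg hsub fun _ _ _ => by positivity
    _ = ∑ k ∈ K, ∑ s : V k, ‖y ⟨k, s⟩‖ ^ q.toReal := Finset.sum_sigma _ _ _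
    _ ≤ ∑ k ∈ K, C ^ q.toReal * (∑ t : V k, ‖f ⟨k, t⟩‖ ^ p.toReal) ^ (q.toReal / p.toReal) :=
        Finset.sum_le_sum fun k _ => h k
    _ = C ^ q.toReal * ∑ k ∈ K, (∑ t : V k, ‖f ⟨k, t⟩‖ ^ p.toReal) ^ (q.toReal / p.toReal) := by
        rw [Finset.mul_sum]
    _ ≤ C ^ q.toReal * (∑ k ∈ K, ∑ t : V k, ‖f ⟨k, t⟩‖ ^ p.toReal) ^ (q.toReal / p.toReal) := by
        gcongr
        exact sum_rpow_le _ hr _ _ fun _ => by positivity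
    _ ≤ C ^ q.toReal * (‖f‖ ^ p.toReal) ^ (q.toReal / p.toReal) := by
        gcongr
        rw [← Finset.sum_sigma K (fun _ => Finset.univ) (fun i => ‖f i‖ ^ p.toReal)]
        exact lp.sum_rpow_le_norm_rpow hP0 f _
    _ = _ := by
        rw [← Real.rpow_mul (norm_nonneg _), mul_div_cancel₀ _ hP0.ne', Real.mul_rpow hC (norm_nonneg _)]

lemma opNorm_blocks (hp : 1 < p) (hpq : p ≤ q) (hq : q < ⊤)
    (U : lp (fun _ : IX => 𝕜) p →L[𝕜] lp (fun _ : IX => 𝕜) q) (M : ∀ k, V k → V k → 𝕜) (C : ℝ) (hC : 0 ≤ C)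
    (hM : ∀ k, NB p.toReal q.toReal (M k) C)
    (hU : ∀ f k s, U f ⟨k, s⟩ = ∑ t, M k s t * f ⟨k, t⟩) : ‖U‖ ≤ C := by
  refine U.opNorm_le_bound hC fun f => ?_
  have hQ0 : 0 < q.toReal := ENNReal.toReal_pos (lt_trans zero_lt_one (hp.trans_le hpq)).ne' hq.ne
  refine lp.norm_le_of_forall_sum_le hQ0 (by positivity) fun F => ?_
  refine lp_le_of_blocks hp hpq hq f _ C hC (fun k => ?_) F
  simp only [hU]
  exact hM k fun t => f ⟨k, t⟩

lemma exists_op (hp : 1 < p) (hpq : p ≤ q) (hq : q < ⊤)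
    (M : ∀ k, V k → V k → 𝕜) (C : ℝ) (hC : 0 ≤ C)
    (hM : ∀ k, NB p.toReal q.toReal (M k) C) :
    ∃ U : lp (fun _ : IX => 𝕜) p →L[𝕜] lp (fun _ : IX => 𝕜) q,
      ∀ f k s, U f ⟨k, s⟩ = ∑ t, M k s t * f ⟨k, t⟩ := by
  have hQ0 : 0 < q.toReal := ENNReal.toReal_pos (lt_trans zero_lt_one (hp.trans_le hpq)).ne' hq.ne
  have hb : ∀ (f : lp (fun _ : IX => 𝕜) p) (F : Finset IX),
      ∑ i ∈ F, ‖∑ t, M i.1 i.2 t * f ⟨i.1, t⟩‖ ^ q.toReal ≤ (C * ‖f‖) ^ q.toReal := fun f F =>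
    lp_le_of_blocks hp hpq hq f (fun i => ∑ t, M i.1 i.2 t * f ⟨i.1, t⟩) C hC
      (fun k => hM k fun t => f ⟨k, t⟩) F
  let L : lp (fun _ : IX => 𝕜) p →ₗ[𝕜] lp (fun _ : IX => 𝕜) q :=
    { toFun := fun f => ⟨fun i => ∑ t, M i.1 i.2 t * f ⟨i.1, t⟩, memℓp_gen' (hb f)⟩
      map_add' := fun f g => by
        ext i
        simp only [lp.coeFn_add, Pi.add_apply, mul_add, Finset.sum_add_distrib]
      map_smul' := fun c f => by
        ext i
        simp only [lp.coeFn_smul, Pi.smul_apply, smul_eq_mul, RingHom.id_apply, Finset.mul_sum, mul_left_comm] }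
  exact ⟨L.mkContinuous C fun f => lp.norm_le_of_forall_sum_le hQ0 (by positivity) (hb f),
    fun f k s => rfl⟩

end op
end APx

namespace APx
namespace Sys
variable (S : Sys) (𝕜 : Type*) [RCLike 𝕜] {P Q : ℝ}

open scoped Classical in
/-- basic matrices -/
def X (n : ℕ) (a b : Om) (k : ℕ) (s t : V k) : 𝕜 :=
  if n ≤ k ∧ EqB n s.1 a ∧ EqB n t.1 b ∧ S.Rel n k s.1 t.1 then sg 𝕜 (S.E 0 k s.1 t.1) else 0

variable {𝕜}

lemma X_pos {n a b k s t} (h1 : n ≤ k) (h2 : EqB n s.1 a) (h3 : EqB n t.1 b) (h4 : S.Rel n k s.1 t.1) :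
    S.X 𝕜 n a b k s t = sg 𝕜 (S.E 0 k s.1 t.1) := if_pos ⟨h1, h2, h3, h4⟩

lemma X_ne {n a b k s t} (h : S.X 𝕜 n a b k s t ≠ 0) :
    n ≤ k ∧ EqB n s.1 a ∧ EqB n t.1 b ∧ S.Rel n k s.1 t.1 := by
  by_contra hc
  exact h (if_neg hc)

lemma stsol {n k a s t} (hnk : n ≤ k) (h1 : S.Rel n k s t) (h2 : EqB n s a) (h3 : Van k s) :
    S.swap.tsol n k a t = s := S.swap.tsol_unique hnk (S.Rel_swap.2 h1) h2 h3

lemma X_NB (hP : 1 < P) (hPQ : P ≤ Q) (n : ℕ) (a b : Om) (k : ℕ) : NB P Q (S.X 𝕜 n a b k) 1 := by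
  classical
  have hQ0 : 0 < Q := by linarith
  by_cases hnk : n ≤ k
  swap
  · have : S.X 𝕜 n a b k = fun _ _ => 0 := by
      funext s t
      exact if_neg fun h => hnk h.1
    rw [this]
    exact NB.zero zero_le_one hQ0
  refine NB.blockM (H := {s : V k // EqB n s.1 a}) (X := Unit) hP hPQ (K := fun _ _ _ => 1) zero_le_one ?_ _
    (fun η _ => η.1) (fun η _ => ⟨S.tsol n k b η.1.1, S.tsol_van hnk⟩) ?_ ?_ ?_
    (fun η _ => sg 𝕜 (S.E 0 k η.1.1 (S.tsol n k b η.1.1))) (fun _ _ => 1) ?_ ?_ ?_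
  · intro η f
    simp only [Finset.univ_unique, Finset.sum_singleton, one_mul, Real.one_rpow]
    rw [← Real.rpow_mul (norm_nonneg _), mul_div_cancel₀ _ (by linarith : P ≠ 0)]
  · intro s t h
    exact ⟨⟨s, (S.X_ne h).2.1⟩, (), rfl⟩
  · intro η _ t h
    obtain ⟨-, h1, h2, h3⟩ := S.X_ne h
    exact ⟨(), Subtype.ext (S.tsol_unique hnk h3 h2 t.2)⟩
  · intro η _ η' _ h
    refine ⟨?_, rfl⟩
    have h' := congrArg Subtype.val h
    simp only at h'
    apply Subtype.ext; apply Subtype.ext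
    rw [← S.stsol hnk (S.tsol_rel n k b η.1.1) η.2 η.1.2, ← S.stsol hnk (S.tsol_rel n k b η'.1.1) η'.2 η'.1.2, h']
  · intro η _; exact sg_norm _
  · intro η _; exact norm_one
  · intro η _ _
    rw [mul_one, mul_one]
    exact S.X_pos hnk η.2 (S.tsol_lo _ _ _ _) (S.tsol_rel _ _ _ _)

/-- linear combination of the bilinear forms on the cell -/
def lin (n : ℕ) (lam : Fin 3 → Z2) (a b : Om) (p q : S.J n) : Z2 :=
  ∑ i, lam i * S.bil n i (S.shA n p a) (S.swap.shA n q b)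

lemma NB_lin (hP : 1 < P) (hPQ : P ≤ Q) {κ : ℝ} (hκ : 0 < κ) (hκω : κ < omg P Q) (hk : ∀ u v : 𝕜,
    ‖u + v‖ ^ Q + ‖u - v‖ ^ Q ≤ κ ^ Q * (‖u‖ ^ P + ‖v‖ ^ P) ^ (Q / P))
    (n : ℕ) (lam : Fin 3 → Z2) (hl : lam ≠ 0) (c : Z2) (a b : Om) :
    NB P Q (fun p q => sg 𝕜 (S.lin n lam a b p q + c)) (omg P Q ^ (2 * S.D n) * κ ^ S.D n) := by
  have h00 : NB P Q (fun p q : Fin 3 × Fin (S.D n) → Z2 => sg 𝕜 (∑ j, lam j.1 * (p j * q j)))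
      (∏ j : Fin 3 × Fin (S.D n), if lam j.1 = 0 then omg P Q else κ) := by
    convert NB_sign (𝕜 := 𝕜) hP hPQ hκ hk (Fin 3 × Fin (S.D n)) (fun j => lam j.1)
  have h0 := h00.reindex
    (Equiv.addLeft (fun j => a (S.a n j))) (Equiv.addLeft (fun j => b (S.b n j)))
  have h1 := h0.unit (c := sg 𝕜 c) (sg_norm c)
  have hω : 0 < omg P Q := omg_pos
  have hprod : (∏ j : Fin 3 × Fin (S.D n), if lam j.1 = 0 then omg P Q else κ) ≤
      omg P Q ^ (2 * S.D n) * κ ^ S.D n := by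
    rw [Fintype.prod_prod_type]
    have hcon : ∀ i : Fin 3, (∏ x : Fin (S.D n), if lam (i, x).1 = 0 then omg P Q else κ) =
        (if lam i = 0 then omg P Q else κ) ^ S.D n := fun i =>
      (Finset.prod_const (s := (Finset.univ : Finset (Fin (S.D n)))) (if lam i = 0 then omg P Q else κ)).trans
        (by rw [Finset.card_univ, Fintype.card_fin])
    simp only [hcon]
    obtain ⟨i, hi⟩ := Function.ne_iff.1 hl
    rw [← Finset.mul_prod_erase _ _ (Finset.mem_univ i)]
    have hi' : lam i ≠ 0 := hi
    rw [if_neg hi', mul_comm, mul_comm 2, pow_mul]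
    gcongr
    have hcard : (Finset.univ.erase i).card = 2 := by simp
    calc _ ≤ ∏ _j ∈ Finset.univ.erase i, omg P Q ^ S.D n := by
          refine Finset.prod_le_prod (fun j _ => ?_) (fun j _ => ?_)
          · split_ifs <;> positivity
          · split_ifs
            · exact le_rfl
            · gcongr
      _ = _ := by rw [Finset.prod_const, hcard]
  refine NB.mono ?_ (by linarith) (Finset.prod_nonneg fun j _ => by split_ifs <;> positivity) hprod
  convert h1 using 3 with p q
  rw [add_comm, sg_add]
  congr 2
  unfold lin
  rw [Fintype.sum_prod_type]
  refine Finset.sum_congr rfl fun i _ => ?_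
  rw [bil, Finset.mul_sum]
  refine Finset.sum_congr rfl fun l _ => ?_
  rw [shA_a]
  have : S.swap.shA n q b (S.b n (i, l)) = b (S.b n (i, l)) + q (i, l) := S.swap.shA_a n q b (i, l)
  rw [this]
  rfl

end Sys
end APx

namespace APx

lemma sg_ne_neg {𝕜 : Type*} [RCLike 𝕜] {z : Z2} (h : (1 : 𝕜) + sg 𝕜 z ≠ 0) : z = 0 := by
  by_contra hc
  apply h
  rw [sg, if_neg hc]; ring

namespace Sys
variable (S : Sys) (𝕜 : Type*) [RCLike 𝕜] {P Q : ℝ}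

abbrev shB (n : ℕ) (q : S.J n) (t : Om) : Om := S.swap.shA n q t

def cc (n : ℕ) (a b : Om) (p q : S.J n) : Z2 :=
  ∑ m ∈ Finset.range (n + 1), S.shA n p a m * S.bil m 1 (S.shA n p a) (S.shB n q b)
def zz (n : ℕ) (a b : Om) (p q : S.J n) : Z2 :=
  S.bil n 0 (S.shA n p a) (S.shB n q b) + a n + b n

/-- matrix of the small operators -/
def MX (n : ℕ) (a b : Om) (ε δ : S.J n → Z2) (k : ℕ) (s t : V k) : 𝕜 :=
  ∑ p, ∑ q, sg 𝕜 (ε p) * sg 𝕜 (δ q) * sg 𝕜 (S.cc n a b p q) *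
    ((1 + sg 𝕜 (S.zz n a b p q)) * S.X 𝕜 n (S.shA n p a) (S.shB n q b) k s t
      - S.X 𝕜 (n + 1) (S.shA n p a) (S.shB n q b) k s t)

variable {𝕜}
variable {n k : ℕ} {a b : Om} {ε δ : S.J n → Z2}

lemma MX_single {s t : V k} {p q : S.J n} (hs : EqB n s.1 (S.shA n p a)) (ht : EqB n t.1 (S.shB n q b)) :
    S.MX 𝕜 n a b ε δ k s t = sg 𝕜 (ε p) * sg 𝕜 (δ q) * sg 𝕜 (S.cc n a b p q) *
    ((1 + sg 𝕜 (S.zz n a b p q)) * S.X 𝕜 n (S.shA n p a) (S.shB n q b) k s t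
      - S.X 𝕜 (n + 1) (S.shA n p a) (S.shB n q b) k s t) := by
  unfold MX
  have key : ∀ p' q', (p' ≠ p ∨ q' ≠ q) → (1 + sg 𝕜 (S.zz n a b p' q')) *
      S.X 𝕜 n (S.shA n p' a) (S.shB n q' b) k s t
      - S.X 𝕜 (n + 1) (S.shA n p' a) (S.shB n q' b) k s t = 0 := by
    intro p' q' hne
    have h0 : ¬ (EqB n s.1 (S.shA n p' a) ∧ EqB n t.1 (S.shB n q' b)) := by
      rintro ⟨h1, h2⟩
      rcases hne with hne | hne
      · exact hne (S.shA_inj (h1.symm.trans hs))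
      · exact hne (S.swap.shA_inj (h2.symm.trans ht))
    have h1 : S.X 𝕜 n (S.shA n p' a) (S.shB n q' b) k s t = 0 := by
      by_contra hc
      obtain ⟨_, h1, h2, _⟩ := S.X_ne hc
      exact h0 ⟨h1, h2⟩
    have h2 : S.X 𝕜 (n + 1) (S.shA n p' a) (S.shB n q' b) k s t = 0 := by
      by_contra hc
      obtain ⟨_, h1, h2, _⟩ := S.X_ne hc
      exact h0 ⟨h1.mono (by omega), h2.mono (by omega)⟩
    rw [h1, h2, mul_zero, sub_zero]
  rw [Finset.sum_eq_single p, Finset.sum_eq_single q]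
  · intro q' _ h; rw [key p q' (Or.inr h), mul_zero]
  · intro h; exact absurd (Finset.mem_univ _) h
  · intro p' _ h
    exact Finset.sum_eq_zero fun q' _ => by rw [key p' q' (Or.inl h), mul_zero]
  · intro h; exact absurd (Finset.mem_univ _) h

lemma MX_ne {s t : V k} (h : S.MX 𝕜 n a b ε δ k s t ≠ 0) :
    n ≤ k ∧ ∃ p q, EqB n s.1 (S.shA n p a) ∧ EqB n t.1 (S.shB n q b) ∧ S.Rel (n + 1) k s.1 t.1 ∧
      (n < k → t.1 n = b n + (s.1 n + a n)) := by
  unfold MX at h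
  obtain ⟨p, -, h⟩ := Finset.exists_ne_zero_of_sum_ne_zero h
  obtain ⟨q, -, h⟩ := Finset.exists_ne_zero_of_sum_ne_zero h
  have h := right_ne_zero_of_mul h
  by_cases hx : (1 + sg 𝕜 (S.zz n a b p q)) * S.X 𝕜 n (S.shA n p a) (S.shB n q b) k s t = 0
  · rw [hx, zero_sub, neg_ne_zero] at h
    obtain ⟨h1, h2, h3, h4⟩ := S.X_ne h
    refine ⟨by omega, p, q, h2.mono (by omega), h3.mono (by omega), h4, fun _ => ?_⟩
    have e1 := h2 n (by omega)
    have e2 := h3 n (by omega)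
    rw [S.shA_ge le_rfl] at e1
    have e3 : S.shB n q b n = b n := S.swap.shA_ge le_rfl
    rw [e1, e2, e3, Z2_add_self, add_zero]
  · have hz := sg_ne_neg (left_ne_zero_of_mul hx)
    obtain ⟨h1, h2, h3, h4⟩ := S.X_ne (right_ne_zero_of_mul hx)
    refine ⟨h1, p, q, h2, h3, fun m h => h4 m (by omega), fun hnk => ?_⟩
    have e1 := h4 n le_rfl hnk
    rw [S.bil_congr h2 h3] at e1
    unfold zz at hz
    linear_combination e1 + hz - (a n + b n) * two_Z2

section norm
variable (hP : 1 < P) (hPQ : P ≤ Q) {κ : ℝ} (hκ : 0 < κ) (hκω : κ < omg P Q) (hk : ∀ u v : 𝕜,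
    ‖u + v‖ ^ Q + ‖u - v‖ ^ Q ≤ κ ^ Q * (‖u‖ ^ P + ‖v‖ ^ P) ^ (Q / P))
include hP hPQ hκ hκω hk

lemma K_NB (n : ℕ) (lam : Fin 3 → Z2) (hl : lam ≠ 0) (hl0 : lam 0 = 0) (c : Z2) (a b : Om) :
    NB P Q (fun p q => sg 𝕜 (S.lin n lam a b p q) * (1 + sg 𝕜 (S.bil n 0 (S.shA n p a) (S.shB n q b) + c)))
      (2 * (omg P Q ^ (2 * S.D n) * κ ^ S.D n)) := by
  have h1 := S.NB_lin hP hPQ hκ hκω hk n lam hl 0 a b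
  have h2 := S.NB_lin hP hPQ hκ hκω hk n (lam + Pi.single 0 1) (fun h => by
    have := congrFun h 0
    simp [hl0] at this) c a b
  have hω : 0 < omg P Q := omg_pos
  have h3 := h1.add hP hPQ h2 (by positivity) (by positivity)
  rw [two_mul]
  convert h3 using 3 with p q
  rw [mul_add, mul_one, add_zero, ← sg_add]
  congr 2
  simp only [lin, Fin.sum_univ_three]
  simp
  ring

lemma K0_NB (n : ℕ) (c : Z2) (a b : Om) :
    NB P Q (fun p q => sg 𝕜 (S.bil n 0 (S.shA n p a) (S.shB n q b) + c))
      (2 * (omg P Q ^ (2 * S.D n) * κ ^ S.D n)) := by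
  have h2 := S.NB_lin hP hPQ hκ hκω hk n (Pi.single 0 1) (fun h => by
    have := congrFun h 0
    simp at this) c a b
  have hω : 0 < omg P Q := omg_pos
  refine NB.mono ?_ (by linarith) (by positivity) (le_mul_of_one_le_left (by positivity) one_le_two)
  convert h2 using 4 with p q
  simp [lin, Fin.sum_univ_three]

/-- diagonal level `k = n` -/
lemma MX_NB_eq (n : ℕ) (a b : Om) (ε δ : S.J n → Z2) :
    NB P Q (S.MX 𝕜 n a b ε δ n) (2 * (omg P Q ^ (2 * S.D n) * κ ^ S.D n)) := by
  have hω : 0 < omg P Q := omg_pos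
  refine NB.blockM (H := Unit) (X := S.J n) hP hPQ
    (K := fun _ p q => sg 𝕜 (S.lin n ![0, a n, 1] a b p q) *
      (1 + sg 𝕜 (S.bil n 0 (S.shA n p a) (S.shB n q b) + (a n + b n)))) (by positivity)
    (fun _ => S.K_NB hP hPQ hκ hκω hk n _ (fun h => by simpa using congrFun h 2) rfl _ a b) _
    (fun _ p => tr n (S.shA n p a)) (fun _ q => tr n (S.shB n q b)) ?_ ?_ ?_
    (fun _ p => sg 𝕜 (ε p)) (fun _ q => sg 𝕜 (δ q)) (fun _ _ => sg_norm _) (fun _ _ => sg_norm _) ?_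
  · intro s t h
    obtain ⟨-, p, q, h1, h2, -⟩ := S.MX_ne h
    exact ⟨(), p, V_ext ((tr_eq _ _).trans h1.symm)⟩
  · intro _ p t h
    obtain ⟨-, p', q, h1, h2, -⟩ := S.MX_ne h
    exact ⟨q, V_ext ((tr_eq _ _).trans h2.symm)⟩
  · intro _ q _ q' h
    refine ⟨rfl, S.swap.shA_inj (s := b) ?_⟩
    have h' : tr n (S.shB n q b) = tr n (S.shB n q' b) := h
    refine (tr_eq n _).symm.trans ?_
    rw [h']
    exact tr_eq n _
  · intro _ p q
    rw [S.MX_single (tr_eq _ _) (tr_eq _ _), S.X_pos le_rfl (tr_eq _ _) (tr_eq _ _) (fun m h1 h2 => by omega)]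
    have h0 : S.X 𝕜 (n + 1) (S.shA n p a) (S.shB n q b) n (tr n (S.shA n p a)) (tr n (S.shB n q b)) = 0 := by
      by_contra hc
      have := (S.X_ne hc).1
      omega
    have e : S.cc n a b p q + S.E 0 n (tr n (S.shA n p a)).1 (tr n (S.shB n q b)).1
        = S.lin n ![0, a n, 1] a b p q := by
      have e1 : S.E 0 n (tr n (S.shA n p a)).1 (tr n (S.shB n q b)).1 =
          S.E 0 n (S.shA n p a) (S.shB n q b) := by
        unfold E
        rw [S.bil_congr (tr_eq _ _) (tr_eq _ _)]
        congr 1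
        refine Finset.sum_congr rfl fun m hm => ?_
        have hm' := (Finset.mem_Ico.1 hm).2
        rw [tr_eq _ _ m hm', S.bil_congr ((tr_eq _ _).mono hm'.le) ((tr_eq _ _).mono hm'.le)]
      rw [e1, cc, E, Finset.sum_range_succ, Finset.range_eq_Ico, S.shA_ge le_rfl]
      simp only [lin, Fin.sum_univ_three, Matrix.cons_val_zero, Matrix.cons_val_one, Matrix.cons_val]
      linear_combination (∑ m ∈ Finset.Ico 0 n, S.shA n p a m * S.bil m 1 (S.shA n p a) (S.shB n q b)) * two_Z2
    rw [h0, ← e, sg_add, zz, add_assoc]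
    ring

/-- levels `k > n` -/
lemma MX_NB_gt (n : ℕ) (a b : Om) (ε δ : S.J n → Z2) (hnk : n < k) :
    NB P Q (S.MX 𝕜 n a b ε δ k) (2 * (omg P Q ^ (2 * S.D n) * κ ^ S.D n)) := by
  classical
  have hω : 0 < omg P Q := omg_pos
  -- base data
  let bu : V k → Om := fun s => Function.update b n (b n + (s.1 n + a n))
  let t0 : V k → Om := fun s => S.tsol (n + 1) k (bu s) s.1
  have t0v : ∀ s, Van k (t0 s) := fun s => S.tsol_van hnk
  have t0r : ∀ s : V k, S.Rel (n + 1) k s.1 (t0 s) := fun s => S.tsol_rel _ _ _ _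
  have t0n : ∀ s, t0 s n = b n + (s.1 n + a n) := fun s => by
    have := S.tsol_lo (n + 1) k (bu s) s.1 n (by omega)
    simp only [t0, this, bu, Function.update_self]
  have t0lo : ∀ s, EqB n (t0 s) b := fun s m hm => by
    have := S.tsol_lo (n + 1) k (bu s) s.1 m (by omega)
    simp only [t0, this, bu, Function.update_of_ne hm.ne]
  let σ : {s : V k // EqB n s.1 a} → S.J n → V k := fun η p =>
    ⟨S.mvS n k p η.1.1 (t0 η.1), S.mvS_van hnk p⟩
  let τ : {s : V k // EqB n s.1 a} → S.J n → V k := fun η q =>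
    ⟨S.mvT n k q η.1.1 (t0 η.1), S.mvT_van hnk q⟩
  have σlo : ∀ η p, EqB n (σ η p).1 (S.shA n p a) := fun η p =>
    ((S.mvS_lo p).mono (by omega)).trans (S.shA_congr η.2)
  have τlo : ∀ η q, EqB n (τ η q).1 (S.shB n q b) := fun η q =>
    ((S.mvT_lo q).mono (by omega)).trans (S.swap.shA_congr (t0lo _))
  have σn : ∀ η p, (σ η p).1 n = η.1.1 n := fun η p =>
    (S.mvS_lo p n (by omega)).trans (S.shA_ge le_rfl)
  have τn : ∀ η q, (τ η q).1 n = b n + (η.1.1 n + a n) := fun η q =>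
    ((S.mvT_lo q n (by omega)).trans (S.swap.shA_ge le_rfl)).trans (t0n _)
  have στ : ∀ η p q, S.Rel (n + 1) k (σ η p).1 (τ η q).1 := fun η p q =>
    S.mv_rel hnk p q (t0r _) η.1.2 (t0v _)
  have eqs : ∀ {s t : Om}, EqB n s t → s n = t n → EqB (n + 1) s t := by
    intro s t h h' m hm
    rcases Nat.lt_succ_iff_lt_or_eq.1 hm with h1 | rfl
    · exact h m h1
    · exact h'
  refine NB.blockM (H := {s : V k // EqB n s.1 a}) (X := S.J n) hP hPQ
    (K := fun η p q => if η.1.1 n + a n = 0 then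
        sg 𝕜 (S.bil n 0 (S.shA n p a) (S.shB n q b) + (a n + b n)) else
      sg 𝕜 (S.lin n ![0, 1, 0] a b p q) *
      (1 + sg 𝕜 (S.bil n 0 (S.shA n p a) (S.shB n q b) + (a n + b n)))) (by positivity)
    ?_ _ σ τ ?_ ?_ ?_
    (fun η p => sg 𝕜 (ε p) * sg 𝕜 (S.E (n + 1) k (σ η p).1 (t0 η.1)) * sg 𝕜 (S.E (n + 1) k η.1.1 (t0 η.1)))
    (fun η q => sg 𝕜 (δ q) * sg 𝕜 (S.E (n + 1) k η.1.1 (τ η q).1)) ?_ ?_ ?_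
  · intro η
    by_cases hu : η.1.1 n + a n = 0
    · simp only [hu, if_true]
      exact S.K0_NB hP hPQ hκ hκω hk n _ a b
    · simp only [hu, if_false]
      exact S.K_NB hP hPQ hκ hκω hk n _ (fun h => by simpa using congrFun h 1) rfl _ a b
  · intro s t h
    obtain ⟨-, p, q, h1, h2, h3, h4⟩ := S.MX_ne h
    have h4 := h4 hnk
    have hlo : EqB n (S.mvS n k p s.1 t.1) a := by
      have := ((S.mvS_lo (k := k) (s := s.1) (t := t.1) p).mono (Nat.le_succ n)).trans (S.shA_congr (p := p) h1)
      rwa [S.shA_invol] at this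
    have hlo' : EqB n (S.mvT n k q s.1 t.1) b := by
      have := ((S.mvT_lo (k := k) (s := s.1) (t := t.1) q).mono (Nat.le_succ n)).trans
        (S.swap.shA_congr (p := q) h2)
      have e : S.swap.shA n q (S.shB n q b) = b := S.swap.shA_invol n q b
      rwa [e] at this
    have hn1 : S.mvS n k p s.1 t.1 n = s.1 n := (S.mvS_lo p n (by omega)).trans (S.shA_ge le_rfl)
    have hn2 : S.mvT n k q s.1 t.1 n = t.1 n := (S.mvT_lo q n (by omega)).trans (S.swap.shA_ge le_rfl)
    refine ⟨⟨⟨S.mvS n k p s.1 t.1, S.mvS_van hnk p⟩, hlo⟩, p, Subtype.ext ?_⟩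
    have ht : t0 ⟨S.mvS n k p s.1 t.1, S.mvS_van hnk p⟩ = S.mvT n k q s.1 t.1 := by
      refine S.tsol_unique hnk (S.mv_rel hnk p q h3 s.2 t.2) (eqs (fun m hm => ?_) ?_) (S.mvT_van hnk q)
      · simp only [bu, Function.update_of_ne hm.ne]; exact hlo' m hm
      · simp only [bu, Function.update_self]
        rw [hn2, h4, hn1]
    change S.mvS n k p (S.mvS n k p s.1 t.1) (t0 ⟨S.mvS n k p s.1 t.1, S.mvS_van hnk p⟩) = s.1
    rw [ht]
    exact S.mvS_mv hnk p q s.2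
  · intro η p t h
    obtain ⟨-, p', q, h1, h2, h3, h4⟩ := S.MX_ne h
    have h4 := h4 hnk
    refine ⟨q, Subtype.ext ?_⟩
    rw [← S.tsol_unique hnk (στ η p q) (b := t.1) (eqs ((τlo η q).trans h2.symm) ?_) (τ η q).2]
    · exact S.tsol_unique hnk h3 (fun _ _ => rfl) t.2
    · rw [τn, h4, σn]
  · intro η q η' q' h
    have hq : q = q' := by
      apply S.swap.shA_inj (s := b)
      exact (τlo η q).symm.trans (by rw [h]; exact τlo η' q')
    refine ⟨?_, hq⟩
    have hn : η.1.1 n = η'.1.1 n := by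
      have e1 := τn η q
      rw [h, τn] at e1
      exact (add_right_cancel (add_left_cancel e1)).symm
    apply Subtype.ext; apply Subtype.ext
    rw [← S.stsol hnk (S.mvT_rel q) (fun _ _ => rfl) η.1.2 (t := (τ η q).1),
      ← S.stsol hnk (S.mvT_rel q') (eqs (η'.2.trans η.2.symm) hn.symm) η'.1.2 (t := (τ η' q').1), h]
  · intro η p; simp only [norm_mul, sg_norm, mul_one]
  · intro η p; simp only [norm_mul, sg_norm, mul_one]
  · intro η p q
    rw [S.MX_single (σlo η p) (τlo η q)]
    set u := η.1.1 n + a n with hu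
    set z := S.bil n 0 (S.shA n p a) (S.shB n q b) + (a n + b n) with hz
    have ez : S.zz n a b p q = z := by rw [zz, add_assoc]
    -- the sign
    have eE : S.cc n a b p q + S.E 0 k (σ η p).1 (τ η q).1 =
        u * S.bil n 1 (S.shA n p a) (S.shB n q b) + S.E (n + 1) k (σ η p).1 (t0 η.1)
        + S.E (n + 1) k η.1.1 (τ η q).1 + S.E (n + 1) k η.1.1 (t0 η.1) := by
      have e1 : S.E (n + 1) k (σ η p).1 (τ η q).1 = _ := S.E_split hnk p q (t0r η.1) η.1.2 (t0v _)
      have e2 : S.E 0 k (σ η p).1 (τ η q).1 =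
          (∑ m ∈ Finset.range (n + 1), (σ η p).1 m * S.bil m 1 (σ η p).1 (τ η q).1)
          + S.E (n + 1) k (σ η p).1 (τ η q).1 := by
        unfold E
        rw [← Finset.sum_Ico_consecutive _ (Nat.zero_le (n + 1)) hnk, Finset.range_eq_Ico, add_assoc]
      have e3 : ∑ m ∈ Finset.range n, (σ η p).1 m * S.bil m 1 (σ η p).1 (τ η q).1 =
          ∑ m ∈ Finset.range n, S.shA n p a m * S.bil m 1 (S.shA n p a) (S.shB n q b) := by
        refine Finset.sum_congr rfl fun m hm => ?_
        have hm' := Finset.mem_range.1 hm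
        rw [σlo η p m hm', S.bil_congr ((σlo η p).mono hm'.le) ((τlo η q).mono hm'.le)]
      rw [e2, e1, cc, Finset.sum_range_succ, Finset.sum_range_succ, e3, σn,
        S.bil_congr (σlo η p) (τlo η q), S.shA_ge le_rfl, hu]
      linear_combination (∑ m ∈ Finset.range n, S.shA n p a m * S.bil m 1 (S.shA n p a) (S.shB n q b)) * two_Z2
    have eX : (1 + sg 𝕜 z) * S.X 𝕜 n (S.shA n p a) (S.shB n q b) k (σ η p) (τ η q) =
        (1 + sg 𝕜 z) * sg 𝕜 (S.E 0 k (σ η p).1 (τ η q).1) := by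
      by_cases h0 : z = 0
      · rw [S.X_pos hnk.le (σlo η p) (τlo η q)]
        intro m h1 h2
        rcases h1.eq_or_lt with h1 | h1
        · subst h1
          rw [τn, σn, S.bil_congr (σlo η p) (τlo η q)]
          linear_combination -h0 + (a n + b n) * two_Z2
        · exact στ η p q m h1 h2
      · have : (1 : 𝕜) + sg 𝕜 z = 0 := by rw [sg, if_neg h0]; ring
        rw [this, zero_mul, zero_mul]
    have eX1 : S.X 𝕜 (n + 1) (S.shA n p a) (S.shB n q b) k (σ η p) (τ η q) =
        (if u = 0 then 1 else 0) * sg 𝕜 (S.E 0 k (σ η p).1 (τ η q).1) := by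
      by_cases h0 : u = 0
      · rw [if_pos h0, one_mul]
        refine S.X_pos hnk (eqs (σlo η p) ?_) (eqs (τlo η q) ?_) (στ η p q)
        · rw [σn, S.shA_ge le_rfl]; linear_combination h0 - a n * two_Z2
        · have : S.shB n q b n = b n := S.swap.shA_ge le_rfl
          rw [τn, this]; linear_combination h0
      · rw [if_neg h0, zero_mul]
        by_contra hc
        have := (S.X_ne hc).2.1 n (by omega)
        rw [σn, S.shA_ge le_rfl] at this
        apply h0; rw [hu, this, Z2_add_self]
    rw [ez, eX, eX1, ← sub_mul]
    have e5 : sg 𝕜 (S.cc n a b p q) * sg 𝕜 (S.E 0 k (σ η p).1 (τ η q).1) =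
        sg 𝕜 (u * S.bil n 1 (S.shA n p a) (S.shB n q b)) * sg 𝕜 (S.E (n + 1) k (σ η p).1 (t0 η.1))
        * sg 𝕜 (S.E (n + 1) k η.1.1 (τ η q).1) * sg 𝕜 (S.E (n + 1) k η.1.1 (t0 η.1)) := by
      rw [← sg_add, eE]; simp only [sg_add]
    by_cases h0 : u = 0
    · rw [h0, zero_mul, sg_zero] at e5
      simp only [h0, if_true]
      linear_combination (sg 𝕜 (ε p) * sg 𝕜 (δ q) * sg 𝕜 z) * e5
    · have h1 : u = 1 := by
        generalize u = u at h0
        revert u; decide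
      rw [h1, one_mul] at e5
      have el : S.lin n ![0, 1, 0] a b p q = S.bil n 1 (S.shA n p a) (S.shB n q b) := by
        simp [lin, Fin.sum_univ_three]
      simp only [h1, one_ne_zero, if_false, el]
      linear_combination (sg 𝕜 (ε p) * sg 𝕜 (δ q) * (1 + sg 𝕜 z)) * e5

lemma MX_NB (n : ℕ) (a b : Om) (ε δ : S.J n → Z2) (k : ℕ) :
    NB P Q (S.MX 𝕜 n a b ε δ k) (2 * (omg P Q ^ (2 * S.D n) * κ ^ S.D n)) := by
  have hω : 0 < omg P Q := omg_pos
  rcases lt_trichotomy n k with h | h | h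
  · exact S.MX_NB_gt hP hPQ hκ hκω hk n a b ε δ h
  · subst h; exact S.MX_NB_eq hP hPQ hκ hκω hk n a b ε δ
  · have : S.MX 𝕜 n a b ε δ k = fun _ _ => 0 := by
      funext s t
      by_contra hc
      have := (S.MX_ne hc).1
      omega
    rw [this]
    exact NB.zero (by positivity) (by linarith)

end norm
end Sys
end APx

namespace APx
section
variable {𝕜 : Type*} [RCLike 𝕜] {p : ℝ≥0∞} [Fact (1 ≤ p)] {I ι : Type*} [Fintype ι]

lemma sum_coord_le (hp : 1 < p) (hpt : p < ⊤) (y : lp (fun _ : I => 𝕜) p) (g : ι → I) (hg : g.Injective) :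
    ∑ i, ‖y (g i)‖ ≤ (Fintype.card ι : ℝ) ^ (1 - 1 / p.toReal) * ‖y‖ := by
  classical
  have hP1 : 1 < p.toReal := by
    rw [← ENNReal.toReal_one]; exact (ENNReal.toReal_lt_toReal (by simp) hpt.ne).2 hp
  have hP0 : 0 < p.toReal := by linarith
  have h := Real.inner_le_Lp_mul_Lq_of_nonneg (Finset.univ : Finset ι) (p := p.toReal)
    (q := p.toReal.conjExponent) (f := fun i => ‖y (g i)‖) (g := fun _ => 1)
    (Real.HolderConjugate.conjExponent hP1) (fun _ _ => norm_nonneg _) (fun _ _ => zero_le_one)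
  simp only [mul_one, Real.one_rpow, Finset.sum_const, Finset.card_univ, nsmul_eq_mul] at h
  have e : 1 / p.toReal.conjExponent = 1 - 1 / p.toReal := by
    have := (Real.HolderConjugate.conjExponent hP1).inv_add_inv_eq_one
    rw [one_div, one_div]; linarith
  rw [e] at h
  refine h.trans ?_
  rw [mul_comm]
  gcongr
  have h2 := lp.sum_rpow_le_norm_rpow hP0 y (Finset.univ.map ⟨g, hg⟩)
  rw [Finset.sum_map] at h2
  calc _ ≤ (‖y‖ ^ p.toReal) ^ (1 / p.toReal) := by
        gcongr; exact h2
    _ = ‖y‖ := by rw [← Real.rpow_mul (norm_nonneg _), mul_one_div_cancel hP0.ne', Real.rpow_one]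

open scoped Classical in
def ee (𝕜 : Type*) [RCLike 𝕜] (p : ℝ≥0∞) {I : Type*} (i : I) : lp (fun _ : I => 𝕜) p := lp.single p i (1 : 𝕜)

lemma ee_self (i : I) : ee 𝕜 p i i = 1 := by
  classical
  simp [ee, lp.single_apply]
lemma ee_ne {i j : I} (h : j ≠ i) : ee 𝕜 p i j = 0 := by
  classical
  simp [ee, lp.single_apply, h]

lemma norm_sum_ee_rpow (hp : 1 < p) (hpt : p < ⊤) (c : ι → 𝕜) (g : ι → I) (hg : g.Injective) :
    ‖∑ i, c i • ee 𝕜 p (g i)‖ ^ p.toReal = ∑ i, ‖c i‖ ^ p.toReal := by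
  classical
  have hP0 : 0 < p.toReal := ENNReal.toReal_pos (lt_trans zero_lt_one hp).ne' hpt.ne
  let F : I → 𝕜 := fun j => if h : ∃ i, g i = j then c h.choose else 0
  have hF : ∀ i, F (g i) = c i := by
    intro i
    have h : ∃ i', g i' = g i := ⟨i, rfl⟩
    simp only [F, dif_pos h]
    rw [hg h.choose_spec]
  have h := lp.norm_sum_single (E := fun _ : I => 𝕜) (p := p) hP0 F (Finset.univ.map ⟨g, hg⟩)
  rw [Finset.sum_map, Finset.sum_map] at h
  simp only [Function.Embedding.coeFn_mk, hF] at h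
  rw [← h]
  congr 2
  refine Finset.sum_congr rfl fun i _ => ?_
  apply lp.ext
  funext j
  simp [ee, lp.single_apply, Pi.single_apply]

lemma norm_sum_ee_le (hp : 1 < p) (hpt : p < ⊤) (c : ι → 𝕜) (hc : ∀ i, ‖c i‖ ≤ 1) (g : ι → I) (hg : g.Injective) :
    ‖∑ i, c i • ee 𝕜 p (g i)‖ ≤ (Fintype.card ι : ℝ) ^ (1 / p.toReal) := by
  have hP0 : 0 < p.toReal := ENNReal.toReal_pos (lt_trans zero_lt_one hp).ne' hpt.ne
  have h := norm_sum_ee_rpow hp hpt c g hg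
  have h2 : ‖∑ i, c i • ee 𝕜 p (g i)‖ ^ p.toReal ≤ Fintype.card ι := by
    rw [h]
    calc _ ≤ ∑ i : ι, (1 : ℝ) := Finset.sum_le_sum fun i _ => Real.rpow_le_one (norm_nonneg _) (hc i) hP0.le
      _ = _ := by simp
  calc _ = (‖∑ i, c i • ee 𝕜 p (g i)‖ ^ p.toReal) ^ (1 / p.toReal) := by
        rw [← Real.rpow_mul (norm_nonneg _), mul_one_div_cancel hP0.ne', Real.rpow_one]
    _ ≤ _ := by gcongr

lemma norm_ee (hp : 1 < p) (hpt : p < ⊤) (i : I) : ‖ee 𝕜 p i‖ ≤ 1 := by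
  have := norm_sum_ee_le (𝕜 := 𝕜) (ι := Unit) hp hpt (fun _ => 1) (fun _ => by simp) (fun _ => i) (fun _ _ _ => rfl)
  simpa using this

end

section signs
variable {𝕜 : Type*} [RCLike 𝕜] {A : Type*} [Fintype A] [DecidableEq A]

lemma sum_sg_mul (p p' : A) : ∑ ε : A → Z2, sg 𝕜 (ε p) * sg 𝕜 (ε p') =
    if p = p' then (Fintype.card (A → Z2) : 𝕜) else 0 := by
  split_ifs with h
  · subst h
    simp [sg_mul_self]
  · have : ∑ ε : A → Z2, sg 𝕜 (ε p) * sg 𝕜 (ε p') = - ∑ ε : A → Z2, sg 𝕜 (ε p) * sg 𝕜 (ε p') := by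
      conv_lhs => rw [← Equiv.sum_comp (Equiv.addRight (Pi.single p (1 : Z2)))]
      rw [← Finset.sum_neg_distrib]
      refine Finset.sum_congr rfl fun ε _ => ?_
      simp [Ne.symm h, sg_add, sg_one]
    have h2 : (2 : 𝕜) * ∑ ε : A → Z2, sg 𝕜 (ε p) * sg 𝕜 (ε p') = 0 := by linear_combination this
    simpa using h2

/-- sign averaging -/
lemma sign_avg (M : A → A → 𝕜) (B : ℝ)
    (h : ∀ ε : A → Z2, ‖∑ p, ∑ p', sg 𝕜 (ε p) * sg 𝕜 (ε p') * M p p'‖ ≤ B) : ‖∑ p, M p p‖ ≤ B := by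
  have e : ∑ ε : A → Z2, ∑ p, ∑ p', sg 𝕜 (ε p) * sg 𝕜 (ε p') * M p p' =
      (Fintype.card (A → Z2) : 𝕜) * ∑ p, M p p := by
    rw [Finset.sum_comm, Finset.mul_sum]
    refine Finset.sum_congr rfl fun p _ => ?_
    rw [Finset.sum_comm]
    simp only [← Finset.sum_mul, sum_sg_mul]
    simp
  have h1 : ‖(Fintype.card (A → Z2) : 𝕜) * ∑ p, M p p‖ ≤ Fintype.card (A → Z2) * B := by
    rw [← e]
    calc _ ≤ ∑ ε : A → Z2, B := norm_sum_le_of_le _ fun ε _ => h ε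
      _ = _ := by simp
  rw [norm_mul, RCLike.norm_natCast] at h1
  have h0 : (0 : ℝ) < Fintype.card (A → Z2) := by exact_mod_cast Fintype.card_pos
  exact le_of_mul_le_mul_left h1 h0

end signs
end APx

namespace APx

abbrev LL (𝕜 : Type*) [RCLike 𝕜] (p q : ℝ≥0∞) [Fact (1 ≤ p)] [Fact (1 ≤ q)] :=
  lp (fun _ : IX => 𝕜) p →L[𝕜] lp (fun _ : IX => 𝕜) q

lemma LL_ext {𝕜 : Type*} [RCLike 𝕜] {p q : ℝ≥0∞} [Fact (1 ≤ p)] [Fact (1 ≤ q)] {U U' : LL 𝕜 p q}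
    (h : ∀ f k s, U f ⟨k, s⟩ = U' f ⟨k, s⟩) : U = U' := by
  ext f i
  exact h f i.1 i.2

namespace Sys
variable (S : Sys) {𝕜 : Type*} [RCLike 𝕜] {p q : ℝ≥0∞} [Fact (1 ≤ p)] [Fact (1 ≤ q)]

def IsX (x : ℕ → Om → Om → LL 𝕜 p q) : Prop :=
  ∀ n a b f k s, x n a b f ⟨k, s⟩ = ∑ t, S.X 𝕜 n a b k s t * f ⟨k, t⟩

lemma X_congr {n k : ℕ} {a a' b b' : Om} (ha : EqB n a a') (hb : EqB n b b') :
    S.X 𝕜 n a b k = S.X 𝕜 n a' b' k := by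
  funext s t
  have h1 : EqB n s.1 a ↔ EqB n s.1 a' := ⟨fun h => h.trans ha, fun h => h.trans ha.symm⟩
  have h2 : EqB n t.1 b ↔ EqB n t.1 b' := ⟨fun h => h.trans hb, fun h => h.trans hb.symm⟩
  unfold X
  by_cases hc : n ≤ k ∧ EqB n s.1 a ∧ EqB n t.1 b ∧ S.Rel n k s.1 t.1
  · rw [if_pos hc, if_pos (by rwa [h1, h2] at hc)]
  · rw [if_neg hc, if_neg (by rwa [h1, h2] at hc)]

variable {S}
lemma IsX.congr {x : ℕ → Om → Om → LL 𝕜 p q} (hx : S.IsX x) {n : ℕ} {a a' b b' : Om} (ha : EqB n a a') (hb : EqB n b b') :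
    x n a b = x n a' b' := by
  apply LL_ext
  intro f k s
  rw [hx, hx, S.X_congr ha hb]
variable (S)

def dd (x : ℕ → Om → Om → LL 𝕜 p q) (n : ℕ) (a b : Om) : LL 𝕜 p q :=
  (1 + sg 𝕜 (S.bil n 0 a b + a n + b n)) • x n a b - x (n + 1) a b

def xx (x : ℕ → Om → Om → LL 𝕜 p q) (n : ℕ) (a b : Om) (ε δ : S.J n → Z2) : LL 𝕜 p q :=
  ∑ p, ∑ q, (sg 𝕜 (ε p) * sg 𝕜 (δ q) * sg 𝕜 (S.cc n a b p q)) • S.dd x n (S.shA n p a) (S.shB n q b)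

variable {S}
variable {x : ℕ → Om → Om → LL 𝕜 p q} (hx : S.IsX x)
include hx

lemma IsX.dd_congr {n : ℕ} {a a' b b' : Om} (ha : EqB (n + 1) a a') (hb : EqB (n + 1) b b') :
    S.dd x n a b = S.dd x n a' b' := by
  have ha' := ha.mono (Nat.le_succ n)
  have hb' := hb.mono (Nat.le_succ n)
  rw [dd, dd, hx.congr ha hb, hx.congr ha' hb', S.bil_congr ha' hb', ha n (by omega), hb n (by omega)]

lemma IsX.xx_congr {n : ℕ} {a a' b b' : Om} (ha : EqB (n + 1) a a') (hb : EqB (n + 1) b b') (ε δ : S.J n → Z2) :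
    S.xx x n a b ε δ = S.xx x n a' b' ε δ := by
  unfold xx
  refine Finset.sum_congr rfl fun p _ => Finset.sum_congr rfl fun q _ => ?_
  have h1 := S.shA_congr (n := n) (p := p) ha
  have h2 := S.swap.shA_congr (n := n) (p := q) hb
  rw [hx.dd_congr h1 h2]
  congr 3
  unfold cc
  refine Finset.sum_congr rfl fun m hm => ?_
  have hm' := Finset.mem_range.1 hm
  rw [h1 m hm', S.bil_congr (h1.mono (by omega)) (h2.mono (by omega))]

lemma IsX.xx_apply {n : ℕ} {a b : Om} (ε δ : S.J n → Z2) (f k s) :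
    S.xx x n a b ε δ f ⟨k, s⟩ = ∑ t, S.MX 𝕜 n a b ε δ k s t * f ⟨k, t⟩ := by
  have e1 : S.xx x n a b ε δ f ⟨k, s⟩ = ∑ p, ∑ q, (sg 𝕜 (ε p) * sg 𝕜 (δ q) * sg 𝕜 (S.cc n a b p q)) *
      (S.dd x n (S.shA n p a) (S.shB n q b) f ⟨k, s⟩) := by
    simp only [xx, sum_apply, lp.coeFn_sum, Finset.sum_apply,
      smul_apply, lp.coeFn_smul, Pi.smul_apply, smul_eq_mul]
  rw [e1]
  simp only [MX, Finset.sum_mul]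
  conv_rhs => rw [Finset.sum_comm]
  refine Finset.sum_congr rfl fun p _ => ?_
  conv_rhs => rw [Finset.sum_comm]
  refine Finset.sum_congr rfl fun q _ => ?_
  have e2 : S.dd x n (S.shA n p a) (S.shB n q b) f ⟨k, s⟩ =
     (1 + sg 𝕜 (S.zz n a b p q)) * (x n (S.shA n p a) (S.shB n q b) f ⟨k, s⟩) -
      x (n + 1) (S.shA n p a) (S.shB n q b) f ⟨k, s⟩ := by
    have h1 : S.shA n p a n = a n := S.shA_ge le_rfl
    have h2 : S.shB n q b n = b n := S.swap.shA_ge le_rfl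
    rw [dd, h1, h2]
    rfl
  rw [e2, hx, hx, Finset.mul_sum, ← Finset.sum_sub_distrib, Finset.mul_sum]
  refine Finset.sum_congr rfl fun t _ => ?_
  ring

lemma IsX.xx_norm {κ : ℝ} (hp : 1 < p) (hpq : p ≤ q) (hq : q < ⊤) (hκ : 0 < κ) (hκω : κ < omg p.toReal q.toReal)
    (hk : ∀ u v : 𝕜, ‖u + v‖ ^ q.toReal + ‖u - v‖ ^ q.toReal ≤
      κ ^ q.toReal * (‖u‖ ^ p.toReal + ‖v‖ ^ p.toReal) ^ (q.toReal / p.toReal))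
    {n : ℕ} (a b : Om) (ε δ : S.J n → Z2) :
    ‖S.xx x n a b ε δ‖ ≤ 2 * (omg p.toReal q.toReal ^ (2 * S.D n) * κ ^ S.D n) := by
  have hpt := hpq.trans_lt hq
  have hP : 1 < p.toReal := by
    rw [← ENNReal.toReal_one]; exact (ENNReal.toReal_lt_toReal (by simp) hpt.ne).2 hp
  have hPQ : p.toReal ≤ q.toReal := (ENNReal.toReal_le_toReal hpt.ne hq.ne).2 hpq
  have hω : 0 < omg p.toReal q.toReal := omg_pos
  exact opNorm_blocks hp hpq hq _ (S.MX 𝕜 n a b ε δ) _ (by positivity)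
    (fun k => S.MX_NB hP hPQ hκ hκω hk n a b ε δ k) (hx.xx_apply ε δ)

lemma IsX.norm (hp : 1 < p) (hpq : p ≤ q) (hq : q < ⊤) (n : ℕ) (a b : Om) : ‖x n a b‖ ≤ 1 := by
  have hpt := hpq.trans_lt hq
  have hP : 1 < p.toReal := by
    rw [← ENNReal.toReal_one]; exact (ENNReal.toReal_lt_toReal (by simp) hpt.ne).2 hp
  have hPQ : p.toReal ≤ q.toReal := (ENNReal.toReal_le_toReal hpt.ne hq.ne).2 hpq
  exact opNorm_blocks hp hpq hq _ (S.X 𝕜 n a b) _ zero_le_one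
    (fun k => S.X_NB hP hPQ n a b k) (hx n a b)

lemma IsX.cell (hp : 1 < p) (hpq : p ≤ q) (hq : q < ⊤) {n k : ℕ} (hnk : n < k) (s t : V k)
    (hr : S.Rel (n + 1) k s.1 t.1) (T : LL 𝕜 p q →L[𝕜] LL 𝕜 p q) (B : ℝ)
    (hB : ∀ ε δ, ‖T (S.xx x n s.1 t.1 ε δ)‖ ≤ B) (g : S.J n → V k) (hg : ∀ u, (g u).1 = S.mvS n k u s.1 t.1)
    (h : S.J n → V k) (hh : ∀ u, (h u).1 = S.mvT n k u s.1 t.1) :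
    ‖∑ u, ∑ v, sg 𝕜 (S.E 0 k (g u).1 (h v).1) * T (S.dd x n (g u).1 (h v).1) (ee 𝕜 p ⟨k, h v⟩) ⟨k, g u⟩‖ ≤
      (Fintype.card (S.J n) : ℝ) ^ (1 - 1 / q.toReal) * (B * (Fintype.card (S.J n) : ℝ) ^ (1 / p.toReal)) := by
  classical
  have hpt := hpq.trans_lt hq
  have hq1 := hp.trans_le hpq
  have glo : ∀ u, EqB (n + 1) (g u).1 (S.shA n u s.1) := fun u => by rw [hg]; exact S.mvS_lo u
  have hlo : ∀ u, EqB (n + 1) (h u).1 (S.shB n u t.1) := fun u => by rw [hh]; exact S.mvT_lo u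
  have ginj : Function.Injective (fun u => (⟨k, g u⟩ : IX)) := by
    intro u u' e
    have e : g u = g u' := by simpa using e
    apply S.shA_inj (s := s.1)
    have := glo u
    rw [e] at this
    exact (this.symm.trans (glo u')).mono (by omega)
  have hinj : Function.Injective (fun u => (⟨k, h u⟩ : IX)) := by
    intro u u' e
    have e : h u = h u' := by simpa using e
    apply S.swap.shA_inj (s := t.1)
    have := hlo u
    rw [e] at this
    exact (this.symm.trans (hlo u')).mono (by omega)
  set A : S.J n → 𝕜 := fun u => sg 𝕜 (S.E (n + 1) k (g u).1 t.1) with hA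
  set C : S.J n → 𝕜 := fun v => sg 𝕜 (S.E (n + 1) k s.1 (h v).1) with hC
  have hE : ∀ u v, sg 𝕜 (S.E 0 k (g u).1 (h v).1) = sg 𝕜 (S.E (n + 1) k s.1 t.1) *
      (A u * C v * sg 𝕜 (S.cc n s.1 t.1 u v)) := by
    intro u v
    simp only [A, C, ← sg_add]
    congr 1
    have e1 := S.E_split hnk u v hr s.2 t.2
    rw [← hg, ← hh] at e1
    have e2 : S.E 0 k (g u).1 (h v).1 = S.cc n s.1 t.1 u v + S.E (n + 1) k (g u).1 (h v).1 := by
      unfold E cc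
      rw [← Finset.sum_Ico_consecutive _ (Nat.zero_le (n + 1)) (by omega : n + 1 ≤ k), ← add_assoc]
      congr 2
      rw [Finset.range_eq_Ico]
      refine Finset.sum_congr rfl fun m hm => ?_
      have hm' := (Finset.mem_Ico.1 hm).2
      rw [glo u m hm', S.bil_congr ((glo u).mono hm'.le) ((hlo v).mono hm'.le)]
    rw [e2, e1]; ring
  have hd : ∀ u v, S.dd x n (g u).1 (h v).1 = S.dd x n (S.shA n u s.1) (S.shB n v t.1) :=
    fun u v => hx.dd_congr (glo u) (hlo v)
  simp only [hE, hd, mul_assoc]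
  simp only [← Finset.mul_sum]
  rw [norm_mul, sg_norm, one_mul]
  let M : S.J n → S.J n → S.J n → S.J n → 𝕜 := fun u u' v v' => A u' * (C v' * (sg 𝕜 (S.cc n s.1 t.1 u v) *
    T (S.dd x n (S.shA n u s.1) (S.shB n v t.1)) (ee 𝕜 p ⟨k, h v'⟩) ⟨k, g u'⟩))
  have goal' : ‖∑ u, (∑ v, M u u v v)‖ ≤ (Fintype.card (S.J n) : ℝ) ^ (1 - 1 / q.toReal) *
      (B * (Fintype.card (S.J n) : ℝ) ^ (1 / p.toReal)) := by
    refine sign_avg (fun u u' => ∑ v, M u u' v v) _ fun ε => ?_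
    have : ∑ u, ∑ u', sg 𝕜 (ε u) * sg 𝕜 (ε u') * ∑ v, M u u' v v =
        ∑ v, ∑ u, ∑ u', sg 𝕜 (ε u) * sg 𝕜 (ε u') * M u u' v v := by
      rw [Finset.sum_comm]
      simp only [Finset.mul_sum]
      rw [Finset.sum_comm]
      conv_rhs => rw [Finset.sum_comm]
      refine Finset.sum_congr rfl fun u _ => ?_
      rw [Finset.sum_comm]
    rw [this]
    refine sign_avg (fun v v' => ∑ u, ∑ u', sg 𝕜 (ε u) * sg 𝕜 (ε u') * M u u' v v') _ fun δ => ?_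
    have key : ∑ v, ∑ v', sg 𝕜 (δ v) * sg 𝕜 (δ v') * ∑ u, ∑ u', sg 𝕜 (ε u) * sg 𝕜 (ε u') * M u u' v v' =
       ∑ u', sg 𝕜 (ε u') * A u' * T (S.xx x n s.1 t.1 ε δ) (∑ v', (sg 𝕜 (δ v') * C v') • ee 𝕜 p ⟨k, h v'⟩) ⟨k, g u'⟩ := by
      have e3 : ∀ u', T (S.xx x n s.1 t.1 ε δ) (∑ v', (sg 𝕜 (δ v') * C v') • ee 𝕜 p ⟨k, h v'⟩) ⟨k, g u'⟩ =
          ∑ v', (sg 𝕜 (δ v') * C v') * ∑ u, ∑ v, (sg 𝕜 (ε u) * sg 𝕜 (δ v) * sg 𝕜 (S.cc n s.1 t.1 u v)) *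
            T (S.dd x n (S.shA n u s.1) (S.shB n v t.1)) (ee 𝕜 p ⟨k, h v'⟩) ⟨k, g u'⟩ := by
        intro u'
        rw [map_sum, lp.coeFn_sum, Finset.sum_apply]
        refine Finset.sum_congr rfl fun v' _ => ?_
        rw [map_smul, lp.coeFn_smul, Pi.smul_apply, smul_eq_mul, xx]
        congr 1
        simp only [map_sum, map_smul, sum_apply, lp.coeFn_sum, Finset.sum_apply,
          smul_apply, lp.coeFn_smul, Pi.smul_apply, smul_eq_mul]
      simp only [e3, Finset.mul_sum]
      -- reorder
      rw [Finset.sum_comm]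
      have : ∀ f : S.J n → S.J n → S.J n → S.J n → 𝕜, ∑ v', ∑ v, ∑ u, ∑ u', f v' v u u' =
          ∑ u', ∑ v', ∑ u, ∑ v, f v' v u u' := by
        intro f
        conv_rhs => rw [Finset.sum_comm]
        refine Finset.sum_congr rfl fun v' _ => ?_
        have : ∀ v, ∑ u, ∑ u', f v' v u u' = ∑ u', ∑ u, f v' v u u' := fun v => Finset.sum_comm
        simp only [this]
        rw [Finset.sum_comm]
        refine Finset.sum_congr rfl fun u' _ => ?_
        rw [Finset.sum_comm]
      rw [this]
      refine Finset.sum_congr rfl fun u' _ => Finset.sum_congr rfl fun v' _ =>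
        Finset.sum_congr rfl fun u _ => Finset.sum_congr rfl fun v _ => ?_
      simp only [M]; ring
    rw [key]
    set f := ∑ v', (sg 𝕜 (δ v') * C v') • ee 𝕜 p (⟨k, h v'⟩ : IX) with hf
    have hfn : ‖f‖ ≤ (Fintype.card (S.J n) : ℝ) ^ (1 / p.toReal) :=
      norm_sum_ee_le hp hpt _ (fun v => by rw [norm_mul, sg_norm, sg_norm, one_mul]) _ hinj
    calc _ ≤ ∑ u', ‖T (S.xx x n s.1 t.1 ε δ) f ⟨k, g u'⟩‖ := by
          refine norm_sum_le_of_le _ fun u _ => ?_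
          rw [norm_mul, norm_mul, sg_norm, sg_norm, one_mul, one_mul]
      _ ≤ _ := sum_coord_le hq1 hq _ _ ginj
      _ ≤ _ := by
        gcongr
        exact (ContinuousLinearMap.le_opNorm _ _).trans (mul_le_mul (hB ε δ) hfn (norm_nonneg _)
          ((norm_nonneg _).trans (hB ε δ)))
  simpa only [M, Finset.mul_sum] using goal'

end Sys
end APx

namespace APx
namespace Sys
variable (S : Sys) {𝕜 : Type*} [RCLike 𝕜] {p q : ℝ≥0∞} [Fact (1 ≤ p)] [Fact (1 ≤ q)]

open scoped Classical in
def G (n k : ℕ) : Finset (V k × V k) := Finset.univ.filter fun z => S.Rel n k z.1.1 z.2.1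

lemma mem_G {n k : ℕ} {z : V k × V k} : z ∈ S.G n k ↔ S.Rel n k z.1.1 z.2.1 := by
  simp [G]

lemma card_G {n k : ℕ} (hnk : n ≤ k) : (S.G n k).card ≤ 2 ^ (k + n) := by
  classical
  have h : (S.G n k).card ≤ (Finset.univ : Finset (V k × V n)).card := by
    refine Finset.card_le_card_of_injOn (fun z => (z.1, tr n z.2.1)) (fun _ _ => Finset.mem_coe.2 (Finset.mem_univ _)) ?_
    rintro ⟨s, t⟩ hz ⟨s', t'⟩ hz' e
    have hz := S.mem_G.1 (Finset.mem_coe.1 hz)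
    have hz' := S.mem_G.1 (Finset.mem_coe.1 hz')
    simp only [Prod.mk.injEq] at e hz hz'
    obtain ⟨rfl, e⟩ := e
    have hlo : EqB n t.1 t'.1 := by
      have := tr_eq n t.1
      rw [e] at this
      exact this.symm.trans (tr_eq n t'.1)
    have h1 := S.tsol_unique hnk hz (fun _ _ => rfl) t.2
    have h2 := S.tsol_unique hnk hz' hlo.symm t'.2
    rw [Prod.mk.injEq]
    exact ⟨rfl, Subtype.ext (h1.symm.trans h2)⟩
  refine h.trans ?_
  rw [Finset.card_univ, Fintype.card_prod, card_V, card_V, pow_add]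

def be (x : ℕ → Om → Om → LL 𝕜 p q) (n k : ℕ) (T : LL 𝕜 p q →L[𝕜] LL 𝕜 p q) : 𝕜 :=
  ((2 : 𝕜) ^ (k + n))⁻¹ * ∑ z ∈ S.G n k,
    sg 𝕜 (S.E 0 k z.1.1 z.2.1) * T (x n z.1.1 z.2.1) (ee 𝕜 p ⟨k, z.2⟩) ⟨k, z.1⟩

lemma Z2_one_sg (z : Z2) : (1 : 𝕜) + sg 𝕜 z = if z = 0 then 2 else 0 := by
  unfold sg
  split_ifs <;> norm_num

lemma be_sub (x : ℕ → Om → Om → LL 𝕜 p q) {n k : ℕ} (hnk : n < k) (T : LL 𝕜 p q →L[𝕜] LL 𝕜 p q) :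
    S.be x n k T - S.be x (n + 1) k T = ((2 : 𝕜) ^ (k + (n + 1)))⁻¹ * ∑ z ∈ S.G (n + 1) k,
    sg 𝕜 (S.E 0 k z.1.1 z.2.1) * T (S.dd x n z.1.1 z.2.1) (ee 𝕜 p ⟨k, z.2⟩) ⟨k, z.1⟩ := by
  classical
  have hG : S.G n k = (S.G (n + 1) k).filter fun z => S.bil n 0 z.1.1 z.2.1 + z.1.1 n + z.2.1 n = 0 := by
    ext z
    rw [Finset.mem_filter, mem_G, mem_G]
    constructor
    · intro h
      refine ⟨fun m h1 h2 => h m (by omega) h2, ?_⟩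
      rw [h n le_rfl hnk]
      linear_combination (S.bil n 0 z.1.1 z.2.1 + z.1.1 n) * two_Z2
    · rintro ⟨h, h'⟩ m h1 h2
      rcases h1.eq_or_lt with rfl | h1
      · linear_combination h' - (S.bil n 0 z.1.1 z.2.1 + z.1.1 n) * two_Z2
      · exact h m h1 h2
  have e1 : S.be x n k T = ((2 : 𝕜) ^ (k + (n + 1)))⁻¹ * ∑ z ∈ S.G (n + 1) k,
    sg 𝕜 (S.E 0 k z.1.1 z.2.1) * ((1 + sg 𝕜 (S.bil n 0 z.1.1 z.2.1 + z.1.1 n + z.2.1 n)) *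
      T (x n z.1.1 z.2.1) (ee 𝕜 p ⟨k, z.2⟩) ⟨k, z.1⟩) := by
    rw [be, hG, Finset.sum_filter, ← add_assoc, pow_succ, mul_inv, mul_assoc]
    congr 1
    rw [Finset.mul_sum]
    refine Finset.sum_congr rfl fun z _ => ?_
    rw [Z2_one_sg]
    split_ifs
    · ring
    · ring
  rw [e1, be, ← mul_sub, ← Finset.sum_sub_distrib]
  congr 1
  refine Finset.sum_congr rfl fun z _ => ?_
  rw [dd, map_sub, map_smul, ← mul_sub]
  rfl

lemma sum_G_mv {n k : ℕ} (hnk : n < k) (u v : S.J n) (F : V k × V k → 𝕜) :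
    ∑ z ∈ S.G (n + 1) k, F z = ∑ z ∈ S.G (n + 1) k,
      F (⟨S.mvS n k u z.1.1 z.2.1, S.mvS_van hnk u⟩, ⟨S.mvT n k v z.1.1 z.2.1, S.mvT_van hnk v⟩) := by
  symm
  refine Finset.sum_nbij' (fun z => (⟨S.mvS n k u z.1.1 z.2.1, S.mvS_van hnk u⟩, ⟨S.mvT n k v z.1.1 z.2.1, S.mvT_van hnk v⟩))
    (fun z => (⟨S.mvS n k u z.1.1 z.2.1, S.mvS_van hnk u⟩, ⟨S.mvT n k v z.1.1 z.2.1, S.mvT_van hnk v⟩)) ?_ ?_ ?_ ?_ ?_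
  · intro z hz
    rw [mem_G] at hz ⊢
    exact S.mv_rel hnk u v hz z.1.2 z.2.2
  · intro z hz
    rw [mem_G] at hz ⊢
    exact S.mv_rel hnk u v hz z.1.2 z.2.2
  · intro z hz
    exact Prod.ext (Subtype.ext (S.mvS_mv hnk u v z.1.2)) (Subtype.ext (S.mvT_mv hnk u v z.2.2))
  · intro z hz
    exact Prod.ext (Subtype.ext (S.mvS_mv hnk u v z.1.2)) (Subtype.ext (S.mvT_mv hnk u v z.2.2))
  · intro z hz; rfl

variable {S}
variable {x : ℕ → Om → Om → LL 𝕜 p q}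

lemma IsX.be_step (hx : S.IsX x) (hp : 1 < p) (hpq : p ≤ q) (hq : q < ⊤) {n k : ℕ} (hnk : n < k)
    (T : LL 𝕜 p q →L[𝕜] LL 𝕜 p q) (B : ℝ) (hB : ∀ a b ε δ, ‖T (S.xx x n a b ε δ)‖ ≤ B) :
    (Fintype.card (S.J n) : ℝ) ^ 2 * ‖S.be x n k T - S.be x (n + 1) k T‖ ≤
      (Fintype.card (S.J n) : ℝ) ^ (1 - 1 / q.toReal) * (B * (Fintype.card (S.J n) : ℝ) ^ (1 / p.toReal)) := by
  classical
  set R := (Fintype.card (S.J n) : ℝ) ^ (1 - 1 / q.toReal) * (B * (Fintype.card (S.J n) : ℝ) ^ (1 / p.toReal)) with hR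
  have hB0 : 0 ≤ B := (norm_nonneg _).trans (hB 0 0 0 0)
  have hR0 : 0 ≤ R := by positivity
  rw [S.be_sub x hnk]
  set F : V k × V k → 𝕜 := fun z =>
    sg 𝕜 (S.E 0 k z.1.1 z.2.1) * T (S.dd x n z.1.1 z.2.1) (ee 𝕜 p ⟨k, z.2⟩) ⟨k, z.1⟩ with hF
  have e : (Fintype.card (S.J n) : 𝕜) ^ 2 * ∑ z ∈ S.G (n + 1) k, F z =
      ∑ z ∈ S.G (n + 1) k, ∑ u : S.J n, ∑ v : S.J n,
       F (⟨S.mvS n k u z.1.1 z.2.1, S.mvS_van hnk u⟩, ⟨S.mvT n k v z.1.1 z.2.1, S.mvT_van hnk v⟩) := by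
    rw [Finset.sum_comm]
    have : ∀ u : S.J n, (∑ z ∈ S.G (n + 1) k, ∑ v : S.J n,
       F (⟨S.mvS n k u z.1.1 z.2.1, S.mvS_van hnk u⟩, ⟨S.mvT n k v z.1.1 z.2.1, S.mvT_van hnk v⟩)) =
       ∑ v : S.J n, ∑ z ∈ S.G (n + 1) k, F z := by
      intro u
      rw [Finset.sum_comm]
      exact Finset.sum_congr rfl fun v _ => (S.sum_G_mv hnk u v F).symm
    simp only [this, Finset.sum_const, Finset.card_univ, nsmul_eq_mul]
    ring
  have hb : ‖(Fintype.card (S.J n) : 𝕜) ^ 2 * ∑ z ∈ S.G (n + 1) k, F z‖ ≤ (2 : ℝ) ^ (k + (n + 1)) * R := by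
    rw [e]
    calc _ ≤ ∑ z ∈ S.G (n + 1) k, R := by
          refine norm_sum_le_of_le _ fun z hz => ?_
          exact hx.cell hp hpq hq hnk z.1 z.2 (S.mem_G.1 hz) T B (hB _ _)
            (fun u => ⟨S.mvS n k u z.1.1 z.2.1, S.mvS_van hnk u⟩) (fun _ => rfl)
            (fun v => ⟨S.mvT n k v z.1.1 z.2.1, S.mvT_van hnk v⟩) (fun _ => rfl)
      _ = (S.G (n + 1) k).card * R := by rw [Finset.sum_const, nsmul_eq_mul]
      _ ≤ _ := by
        gcongr
        exact_mod_cast S.card_G (by omega : n + 1 ≤ k)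
  rw [norm_mul, norm_pow, RCLike.norm_natCast] at hb
  rw [norm_mul, norm_inv, norm_pow, RCLike.norm_ofNat, mul_left_comm]
  calc _ ≤ ((2 : ℝ) ^ (k + (n + 1)))⁻¹ * (2 ^ (k + (n + 1)) * R) := by gcongr
    _ = R := by rw [← mul_assoc, inv_mul_cancel₀ (by positivity), one_mul]

lemma IsX.be_zero (hx : S.IsX x) (hp : 1 < p) (hpq : p ≤ q) (hq : q < ⊤) (k : ℕ)
    (T : LL 𝕜 p q →L[𝕜] LL 𝕜 p q) : ‖S.be x 0 k T‖ ≤ ‖T (x 0 0 0)‖ := by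
  have hpt := hpq.trans_lt hq
  have hq0 : q ≠ 0 := (zero_lt_one.trans (hp.trans_le hpq)).ne'
  rw [be, norm_mul, norm_inv, norm_pow, RCLike.norm_ofNat]
  have h : ‖∑ z ∈ S.G 0 k, sg 𝕜 (S.E 0 k z.1.1 z.2.1) * T (x 0 z.1.1 z.2.1) (ee 𝕜 p ⟨k, z.2⟩) ⟨k, z.1⟩‖ ≤
      2 ^ (k + 0) * ‖T (x 0 0 0)‖ := by
    calc _ ≤ ∑ z ∈ S.G 0 k, ‖T (x 0 0 0)‖ := by
          refine norm_sum_le_of_le _ fun z hz => ?_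
          rw [norm_mul, sg_norm, one_mul, hx.congr (n := 0) (a' := 0) (b' := 0) (fun m hm => absurd hm (by omega))
            (fun m hm => absurd hm (by omega))]
          refine (lp.norm_apply_le_norm hq0 _ _).trans ?_
          refine (ContinuousLinearMap.le_opNorm _ _).trans ?_
          exact mul_le_of_le_one_right (norm_nonneg _) (norm_ee hp hpt _)
      _ = (S.G 0 k).card * ‖T (x 0 0 0)‖ := by rw [Finset.sum_const, nsmul_eq_mul]
      _ ≤ _ := by
        gcongr
        exact_mod_cast S.card_G (by omega : 0 ≤ k)
  calc _ ≤ ((2 : ℝ) ^ (k + 0))⁻¹ * (2 ^ (k + 0) * ‖T (x 0 0 0)‖) := by gcongr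
    _ = _ := by rw [← mul_assoc, inv_mul_cancel₀ (by positivity), one_mul]

lemma G_self (k : ℕ) : S.G k k = Finset.univ := by
  ext z
  simp only [mem_G, Finset.mem_univ, iff_true]
  intro m h1 h2; omega

lemma IsX.be_id (hx : S.IsX x) (k : ℕ) : S.be x k k (ContinuousLinearMap.id 𝕜 _) = 1 := by
  classical
  have h : ∀ z : V k × V k, sg 𝕜 (S.E 0 k z.1.1 z.2.1) *
      (ContinuousLinearMap.id 𝕜 (LL 𝕜 p q)) (x k z.1.1 z.2.1) (ee 𝕜 p ⟨k, z.2⟩) ⟨k, z.1⟩ = 1 := by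
    intro z
    rw [ContinuousLinearMap.id_apply, hx, Finset.sum_eq_single z.2]
    · rw [ee_self, mul_one, S.X_pos le_rfl (fun _ _ => rfl) (fun _ _ => rfl) (fun m h1 h2 => by omega), sg_mul_self]
    · intro t _ ht
      rw [ee_ne (by simpa using ht), mul_zero]
    · intro h; exact absurd (Finset.mem_univ _) h
  rw [be, G_self]
  simp only [h, Finset.sum_const, Finset.card_univ, Fintype.card_prod, card_V, nsmul_eq_mul, mul_one]
  push_cast
  rw [← pow_add]
  exact inv_mul_cancel₀ (pow_ne_zero _ two_ne_zero)

lemma be_add (n k : ℕ) (T T' : LL 𝕜 p q →L[𝕜] LL 𝕜 p q) : S.be x n k (T + T') = S.be x n k T + S.be x n k T' := by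
  unfold be
  rw [← mul_add, ← Finset.sum_add_distrib]
  congr 1
  refine Finset.sum_congr rfl fun z _ => ?_
  rw [← mul_add]
  rfl

lemma finrank_repr {L : Type*} [NormedAddCommGroup L] [NormedSpace 𝕜 L] (T : L →L[𝕜] L)
    (hT : FiniteDimensional 𝕜 (LinearMap.range (T : L →ₗ[𝕜] L))) :
    ∃ (m : ℕ) (f : Fin m → (L →L[𝕜] 𝕜)) (y : Fin m → L), ∀ z, T z = ∑ j, f j z • y j := by
  let W := LinearMap.range (T : L →ₗ[𝕜] L)
  let bs := Module.finBasis 𝕜 W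
  let T' : L →L[𝕜] W := T.codRestrict W fun y => ⟨y, rfl⟩
  refine ⟨_, fun j => (LinearMap.toContinuousLinearMap (bs.coord j)).comp T', fun j => (bs j : L), fun y => ?_⟩
  have h := bs.sum_repr (T' y)
  have h2 := congrArg (Subtype.val) h
  rw [AddSubmonoidClass.coe_finsetSum] at h2
  exact h2.symm

/-- finite rank operators have vanishing limit trace -/
lemma IsX.be_finite (hx : S.IsX x) (hp : 1 < p) (hpq : p ≤ q) (hq : q < ⊤)
    (T : LL 𝕜 p q →L[𝕜] LL 𝕜 p q) (hT : FiniteDimensional 𝕜 (LinearMap.range (T : LL 𝕜 p q →ₗ[𝕜] LL 𝕜 p q))) :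
    ∃ C : ℝ, ∀ k : ℕ, ‖S.be x k k T‖ ≤ C * ((2 : ℝ) ^ k) ^ (-(1 / q.toReal)) := by
  classical
  have hpt := hpq.trans_lt hq
  have hq1 := hp.trans_le hpq
  obtain ⟨m, f, y, hTf⟩ := finrank_repr T hT
  refine ⟨∑ j, ‖f j‖ * ‖y j‖, fun k => ?_⟩
  set N : ℝ := 2 ^ k with hN
  have hN0 : 0 < N := by positivity
  have hcoef : ∀ z : V k × V k, ‖sg 𝕜 (S.E 0 k z.1.1 z.2.1) * T (x k z.1.1 z.2.1) (ee 𝕜 p ⟨k, z.2⟩) ⟨k, z.1⟩‖ ≤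
      ∑ j, ‖f j‖ * ‖y j (ee 𝕜 p ⟨k, z.2⟩) ⟨k, z.1⟩‖ := by
    intro z
    rw [norm_mul, sg_norm, one_mul, hTf]
    simp only [sum_apply, lp.coeFn_sum, Finset.sum_apply, smul_apply, lp.coeFn_smul, Pi.smul_apply, smul_eq_mul]
    refine norm_sum_le_of_le _ fun j _ => ?_
    rw [norm_mul]
    gcongr
    exact (f j).le_of_opNorm_le_of_le le_rfl (hx.norm hp hpq hq k _ _) |>.trans (by rw [mul_one])
  have hj : ∀ j, ∑ z : V k × V k, ‖y j (ee 𝕜 p ⟨k, z.2⟩) ⟨k, z.1⟩‖ ≤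
      N * (N ^ (1 - 1 / q.toReal) * ‖y j‖) := by
    intro j
    rw [Fintype.sum_prod_type, Finset.sum_comm]
    calc _ ≤ ∑ t : V k, N ^ (1 - 1 / q.toReal) * ‖y j‖ := by
          refine Finset.sum_le_sum fun t _ => ?_
          have := sum_coord_le hq1 hq (y j (ee 𝕜 p ⟨k, t⟩)) (fun s : V k => (⟨k, s⟩ : IX))
            (fun s s' h => by simpa using h)
          rw [card_V] at this
          push_cast at this
          refine this.trans ?_
          gcongr
          refine (ContinuousLinearMap.le_opNorm _ _).trans ?_
          exact mul_le_of_le_one_right (norm_nonneg _) (norm_ee hp hpt _)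
      _ = _ := by simp [card_V, hN]
  rw [be, norm_mul, norm_inv, norm_pow, RCLike.norm_ofNat, G_self]
  have h1 : ‖∑ z : V k × V k, sg 𝕜 (S.E 0 k z.1.1 z.2.1) * T (x k z.1.1 z.2.1) (ee 𝕜 p ⟨k, z.2⟩) ⟨k, z.1⟩‖ ≤
      ∑ j, ‖f j‖ * (N * (N ^ (1 - 1 / q.toReal) * ‖y j‖)) := by
    refine (norm_sum_le_of_le _ fun z _ => hcoef z).trans ?_
    rw [Finset.sum_comm]
    refine Finset.sum_le_sum fun j _ => ?_
    rw [← Finset.mul_sum]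
    gcongr
    exact hj j
  calc _ ≤ ((2 : ℝ) ^ (k + k))⁻¹ * ∑ j, ‖f j‖ * (N * (N ^ (1 - 1 / q.toReal) * ‖y j‖)) := by gcongr
    _ = _ := by
      rw [pow_add, Finset.mul_sum, Finset.sum_mul]
      refine Finset.sum_congr rfl fun j _ => ?_
      rw [sub_eq_add_neg, Real.rpow_add hN0, Real.rpow_one]
      field_simp
      rw [hN]; ring
end Sys
end APx

namespace APx
open Filter Topology

lemma Sys.summable (S : Sys) {ν : ℝ} (h0 : 0 < ν) (h1 : ν < 1) : Summable fun n => ν ^ S.D n := by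
  obtain ⟨j, hj⟩ := exists_pow_lt_of_lt_one (by norm_num : (0 : ℝ) < 1 / 2) h1
  obtain ⟨N, hN⟩ := S.growth (2 * j)
  have hs : Summable fun n : ℕ => 4 * (1 / (n : ℝ) ^ 2) :=
    (Real.summable_one_div_nat_pow.2 (by norm_num : 1 < 2)).mul_left 4
  refine Summable.of_norm_bounded_eventually_nat hs ?_
  filter_upwards [eventually_ge_atTop (max N 1)] with n hn
  have hn1 : 1 ≤ n := (le_max_right _ _).trans hn
  rw [Real.norm_of_nonneg (by positivity)]
  have a1 : ν ^ S.D n ≤ ν ^ (2 * j * Nat.log 2 n) :=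
    pow_le_pow_of_le_one h0.le h1.le (hN n ((le_max_left _ _).trans hn))
  have a2 : ν ^ (2 * j * Nat.log 2 n) ≤ (1 / 2) ^ (2 * Nat.log 2 n) := by
    rw [show 2 * j * Nat.log 2 n = j * (2 * Nat.log 2 n) by ring, pow_mul]
    gcongr
  have a3 : (n : ℝ) ≤ 2 * 2 ^ Nat.log 2 n := by
    have := (Nat.lt_pow_succ_log_self (b := 2) (by norm_num) n).le
    rw [pow_succ, mul_comm] at this
    exact_mod_cast this
  have hnp : (0 : ℝ) < n := by exact_mod_cast hn1
  refine a1.trans (a2.trans ?_)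
  rw [mul_comm 2, pow_mul, one_div, inv_pow, inv_pow, one_div, ← div_eq_mul_inv, le_div_iff₀ (by positivity),
    inv_mul_le_iff₀ (by positivity)]
  nlinarith

section
variable {𝕜 : Type*} [RCLike 𝕜] {p q : ℝ≥0∞} [Fact (1 ≤ p)] [Fact (1 ≤ q)]

lemma compact_aux {L : Type*} [NormedAddCommGroup L] {W : ℕ → Type*} [∀ n, Finite (W n)]
    (u : (Σ n, W n) → L) (g : ℕ → ℝ) (hg : Tendsto g atTop (𝓝 0)) (hu : ∀ i, ‖u i‖ ≤ g i.1) :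
    IsCompact (insert 0 (Set.range u)) := by
  refine Filter.Tendsto.isCompact_insert_range_of_cofinite ?_
  rw [Metric.tendsto_nhds]
  intro ε hε
  obtain ⟨N, hN⟩ := eventually_atTop.1 (hg.eventually (gt_mem_nhds hε))
  rw [eventually_cofinite]
  have : {i : Σ n, W n | ¬ dist (u i) 0 < ε} ⊆ ⋃ n ∈ Set.Iio N, Set.range (Sigma.mk n) := by
    rintro ⟨n, w⟩ h
    simp only [Set.mem_iUnion]
    refine ⟨n, ?_, w, rfl⟩
    by_contra hc
    apply h
    rw [dist_zero_right]
    exact (hu _).trans_lt (hN n (not_lt.1 hc))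
  refine Set.Finite.subset ?_ this
  exact (Set.finite_Iio N).biUnion fun n _ => Set.finite_range _

theorem not_ap_LL (hp : 1 < p) (hpq : p ≤ q) (hq : q < ⊤) : ¬ HasAP 𝕜 (LL 𝕜 p q) := by
  classical
  intro hAP
  have hpt := hpq.trans_lt hq
  have hP : 1 < p.toReal := by
    rw [← ENNReal.toReal_one]; exact (ENNReal.toReal_lt_toReal (by simp) hpt.ne).2 hp
  have hPQ : p.toReal ≤ q.toReal := (ENNReal.toReal_le_toReal hpt.ne hq.ne).2 hpq
  have hQ0 : 0 < q.toReal := by linarith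
  obtain ⟨κ, hκ, hκω, hk⟩ := exists_kap 𝕜 hP hPQ
  set ω := omg p.toReal q.toReal with hω
  have hω0 : 0 < ω := omg_pos
  let S := sysX
  have hex := fun n a b => exists_op (𝕜 := 𝕜) hp hpq hq (S.X 𝕜 n a b) 1 zero_le_one
    (fun k => S.X_NB hP hPQ n a b k)
  choose x hx using hex
  have hx : S.IsX x := hx
  set ν := Real.sqrt (κ / ω) with hν
  have hν0 : 0 < ν := Real.sqrt_pos.2 (by positivity)
  have hν2 : ν * ν = κ / ω := Real.mul_self_sqrt (by positivity)
  have hν1 : ν < 1 := by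
    have : κ / ω < 1 := (div_lt_one hω0).2 hκω
    nlinarith
  have hsum := S.summable hν0 hν1
  set A := ∑' n, ν ^ S.D n with hA
  have hA0 : 0 ≤ A := tsum_nonneg fun n => by positivity
  let r : ℕ → ℝ := fun n => Fintype.card (S.J n)
  have hr : ∀ n, r n = 2 ^ (3 * (S.D n : ℝ)) := by
    intro n
    have : Fintype.card (S.J n) = 2 ^ (3 * S.D n) := by simp [Sys.J, ZMod.card]
    simp only [r, this]
    push_cast
    rw [← Real.rpow_natCast]
    push_cast; rfl
  have hr0 : ∀ n, 0 < r n := fun n => by rw [hr]; positivity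
  let R : ℕ → ℝ := fun n => r n ^ (1 - 1 / q.toReal) * r n ^ (1 / p.toReal)
  have hR0 : ∀ n, 0 < R n := fun n => by have := hr0 n; positivity
  have hRω : ∀ n, R n * ω ^ (3 * S.D n) = r n ^ 2 := by
    intro n
    have e1 : ω ^ (3 * S.D n) = r n ^ (1 / q.toReal + (1 - 1 / p.toReal)) := by
      rw [hr, ← Real.rpow_mul (by norm_num), hω, omg, ← Real.rpow_natCast, ← Real.rpow_mul (by norm_num)]
      congr 1; push_cast; ring
    simp only [R]
    rw [e1, ← Real.rpow_add (hr0 n), ← Real.rpow_add (hr0 n), ← Real.rpow_natCast (r n) 2]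
    congr 1; push_cast; ring
  let c : ℕ → ℝ := fun n => R n / (ν ^ S.D n * r n ^ 2)
  have hc0 : ∀ n, 0 < c n := fun n => by
    have := hr0 n; have := hR0 n
    simp only [c]; positivity
  have hcn : ∀ n, c n * (2 * (ω ^ (2 * S.D n) * κ ^ S.D n)) = 2 * ν ^ S.D n := by
    intro n
    simp only [c]
    have h1 := hRω n
    have h2 : κ ^ S.D n = ω ^ S.D n * (ν ^ S.D n * ν ^ S.D n) := by
      rw [← mul_pow, hν2, ← mul_pow, mul_div_cancel₀ _ hω0.ne']
    have h3 : r n ^ 2 ≠ 0 := pow_ne_zero _ (hr0 n).ne'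
    rw [h2, ← h1]
    have := (hR0 n).ne'
    have e : ω ^ (3 * S.D n) = ω ^ (2 * S.D n) * ω ^ S.D n := by rw [← pow_add]; congr 1; ring
    rw [e]
    field_simp
  let W : ℕ → Type := fun n => V (n + 1) × V (n + 1) × (S.J n → Z2) × (S.J n → Z2)
  have : ∀ n, Finite (W n) := fun n => by simp only [W]; infer_instance
  let u : (Σ n, W n) → LL 𝕜 p q := fun i => (c i.1 : 𝕜) • S.xx x i.1 i.2.1.1 i.2.2.1.1 i.2.2.2.1 i.2.2.2.2
  have hu : ∀ i, ‖u i‖ ≤ 2 * ν ^ S.D i.1 := by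
    intro i
    simp only [u]
    rw [norm_smul, RCLike.norm_ofReal, abs_of_pos (hc0 _), ← hcn]
    have := (hc0 i.1).le
    gcongr
    exact hx.xx_norm hp hpq hq hκ hκω hk _ _ _ _
  have hcomp : IsCompact (insert 0 (Set.range u)) := by
    refine compact_aux u (fun n => 2 * ν ^ S.D n) ?_ hu
    simpa using (hsum.tendsto_atTop_zero).const_mul 2
  set η := 1 / (2 * (1 + A)) with hη
  have hη0 : 0 < η := by positivity
  obtain ⟨T, hTf, hT⟩ := hAP _ (hcomp.union (isCompact_singleton (x := x 0 0 0))) η hη0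
  set U := T - ContinuousLinearMap.id 𝕜 (LL 𝕜 p q) with hU
  have hUK : ∀ y ∈ insert 0 (Set.range u) ∪ {x 0 0 0}, ‖U y‖ ≤ η := fun y hy => (hT y hy).le
  have hstep : ∀ n k, n < k → ‖S.be x n k U - S.be x (n + 1) k U‖ ≤ η * ν ^ S.D n := by
    intro n k hnk
    have hB : ∀ a b ε δ, ‖U (S.xx x n a b ε δ)‖ ≤ η / c n := by
      intro a b ε δ
      rw [hx.xx_congr (tr_eq (n + 1) a).symm (tr_eq (n + 1) b).symm]
      have := hUK (u ⟨n, (tr (n + 1) a, tr (n + 1) b, ε, δ)⟩) (Or.inl (Or.inr ⟨_, rfl⟩))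
      simp only [u] at this
      rw [map_smul, norm_smul, RCLike.norm_ofReal, abs_of_pos (hc0 _)] at this
      rw [le_div_iff₀ (hc0 n), mul_comm]
      exact this
    have h := hx.be_step hp hpq hq hnk U _ hB
    change r n ^ 2 * _ ≤ r n ^ (1 - 1 / q.toReal) * (η / c n * r n ^ (1 / p.toReal)) at h
    have e : r n ^ (1 - 1 / q.toReal) * (η / c n * r n ^ (1 / p.toReal)) = r n ^ 2 * (η * ν ^ S.D n) := by
      have e' : r n ^ (1 - 1 / q.toReal) * (η / c n * r n ^ (1 / p.toReal)) = η / c n * R n := by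
        simp only [R]; ring
      rw [e']
      simp only [c]
      have := (hR0 n).ne'
      have := (hr0 n).ne'
      field_simp
    rw [e] at h
    exact le_of_mul_le_mul_left h (pow_pos (hr0 n) 2)
  have hind : ∀ k n, n ≤ k → ‖S.be x n k U‖ ≤ η * (1 + ∑ m ∈ Finset.range n, ν ^ S.D m) := by
    intro k n
    induction n with
    | zero =>
      intro _
      simp only [Finset.range_zero, Finset.sum_empty, add_zero, mul_one]
      exact (hx.be_zero hp hpq hq k U).trans (hUK _ (Or.inr rfl))
    | succ n ih =>
      intro hn
      have h1 := ih (by omega)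
      have h2 := hstep n k (by omega)
      rw [Finset.sum_range_succ]
      have h3 : ‖S.be x (n + 1) k U‖ ≤ ‖S.be x n k U‖ + ‖S.be x n k U - S.be x (n + 1) k U‖ := by
        have := norm_sub_le (S.be x n k U) (S.be x n k U - S.be x (n + 1) k U)
        rwa [sub_sub_cancel] at this
      calc _ ≤ _ := h3
        _ ≤ _ := add_le_add h1 h2
        _ = _ := by ring
  have hhalf : ∀ k, ‖S.be x k k U‖ ≤ 1 / 2 := by
    intro k
    refine (hind k k le_rfl).trans ?_
    have : ∑ m ∈ Finset.range k, ν ^ S.D m ≤ A := hsum.sum_le_tsum _ fun n _ => by positivity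
    calc _ ≤ η * (1 + A) := by gcongr
      _ = 1 / 2 := by rw [hη]; field_simp
  have hbig : ∀ k, 1 / 2 ≤ ‖S.be x k k T‖ := by
    intro k
    have e : T = ContinuousLinearMap.id 𝕜 (LL 𝕜 p q) + U := by rw [hU]; abel
    rw [e, Sys.be_add, hx.be_id]
    have := norm_sub_le ((1 : 𝕜) + S.be x k k U) (S.be x k k U)
    rw [add_sub_cancel_right, norm_one] at this
    linarith [hhalf k]
  obtain ⟨C, hC⟩ := hx.be_finite hp hpq hq T hTf
  have hlim : Tendsto (fun k : ℕ => C * ((2 : ℝ) ^ k) ^ (-(1 / q.toReal))) atTop (𝓝 (C * 0)) := by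
    refine Tendsto.const_mul _ ?_
    exact (tendsto_rpow_neg_atTop (by positivity)).comp (tendsto_pow_atTop_atTop_of_one_lt (by norm_num))
  have := ge_of_tendsto' hlim fun k => (hbig k).trans (hC k)
  rw [mul_zero] at this
  norm_num at this

end
end APx

namespace APx
open Filter Topology

section
variable {𝕜 : Type*} [RCLike 𝕜] {p : ℝ≥0∞} [Fact (1 ≤ p)] {I : Type*}

lemma hasSum_ee (hpt : p < ⊤) (a : lp (fun _ : I => 𝕜) p) : HasSum (fun i => a i • ee 𝕜 p i) a := by
  classical
  have h := lp.hasSum_single (E := fun _ : I => 𝕜) (p := p) hpt.ne a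
  convert h using 2 with i
  apply lp.ext
  funext j
  simp [ee, lp.single_apply, Pi.single_apply]

lemma lp_norm_rpow_le {P0 : 0 < p.toReal} (a : lp (fun _ : I => 𝕜) p) (t : Finset I) :
    (∑ i ∈ t, ‖a i‖ ^ p.toReal) ^ (1 / p.toReal) ≤ ‖a‖ := by
  have h2 := lp.sum_rpow_le_norm_rpow P0 a t
  calc _ ≤ (‖a‖ ^ p.toReal) ^ (1 / p.toReal) := by gcongr
    _ = ‖a‖ := by rw [← Real.rpow_mul (norm_nonneg _), mul_one_div_cancel P0.ne', Real.rpow_one]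

lemma synth {Y : Type*} [NormedAddCommGroup Y] [NormedSpace 𝕜 Y] [CompleteSpace Y] (hpt : p < ⊤)
    (y : I → Y) (C : ℝ) (hC : 0 ≤ C)
    (h : ∀ (t : Finset I) (a : I → 𝕜), ‖∑ i ∈ t, a i • y i‖ ≤ C * (∑ i ∈ t, ‖a i‖ ^ p.toReal) ^ (1 / p.toReal)) :
    ∃ J : lp (fun _ : I => 𝕜) p →L[𝕜] Y, ∀ i, J (ee 𝕜 p i) = y i := by
  classical
  have hp1 : 1 ≤ p := Fact.out
  have P0 : 0 < p.toReal := ENNReal.toReal_pos (zero_lt_one.trans_le hp1).ne' hpt.ne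
  have hs : ∀ a : lp (fun _ : I => 𝕜) p, Summable fun i => a i • y i := by
    intro a
    rw [summable_iff_vanishing_norm]
    intro ε hε
    have hsum := (lp.memℓp a).summable P0
    rw [summable_iff_vanishing_norm] at hsum
    obtain ⟨s, hs⟩ := hsum ((ε / (C + 1)) ^ p.toReal) (by positivity)
    refine ⟨s, fun t ht => ?_⟩
    have h1 := hs t ht
    rw [Real.norm_of_nonneg (by positivity)] at h1
    have h2 : (∑ i ∈ t, ‖a i‖ ^ p.toReal) ^ (1 / p.toReal) ≤ ε / (C + 1) := by
      calc _ ≤ ((ε / (C + 1)) ^ p.toReal) ^ (1 / p.toReal) := by gcongr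
        _ = _ := by rw [← Real.rpow_mul (by positivity), mul_one_div_cancel P0.ne', Real.rpow_one]
    calc _ ≤ C * (∑ i ∈ t, ‖a i‖ ^ p.toReal) ^ (1 / p.toReal) := h t a
      _ ≤ C * (ε / (C + 1)) := by gcongr
      _ < ε := by
        rw [mul_div_assoc', div_lt_iff₀ (by positivity)]; nlinarith
  let L : lp (fun _ : I => 𝕜) p →ₗ[𝕜] Y :=
    { toFun := fun a => ∑' i, a i • y i
      map_add' := fun a b => by
        rw [← (hs a).tsum_add (hs b)]
        refine tsum_congr fun i => ?_
        rw [lp.coeFn_add, Pi.add_apply, add_smul]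
      map_smul' := fun c a => by
        rw [RingHom.id_apply, ← (hs a).tsum_const_smul]
        refine tsum_congr fun i => ?_
        rw [lp.coeFn_smul, Pi.smul_apply, smul_eq_mul, mul_smul] }
  refine ⟨L.mkContinuous C fun a => ?_, fun i => ?_⟩
  · refine le_of_tendsto ((hs a).hasSum.norm) (Eventually.of_forall fun t => ?_)
    refine (h t a).trans ?_
    gcongr
    exact lp_norm_rpow_le (P0 := P0) a t
  · change ∑' j, ee 𝕜 p i j • y j = y i
    rw [tsum_eq_single i, ee_self, one_smul]
    intro j hj
    rw [ee_ne hj, zero_smul]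

lemma anal {Y : Type*} [NormedAddCommGroup Y] [NormedSpace 𝕜 Y] (hpt : p < ⊤)
    (ζ : I → (Y →L[𝕜] 𝕜)) (C : ℝ) (hC : 0 ≤ C)
    (h : ∀ (t : Finset I) (x : Y), ∑ i ∈ t, ‖ζ i x‖ ^ p.toReal ≤ (C * ‖x‖) ^ p.toReal) :
    ∃ Pr : Y →L[𝕜] lp (fun _ : I => 𝕜) p, (∀ x i, Pr x i = ζ i x) ∧ ‖Pr‖ ≤ C := by
  have hp1 : 1 ≤ p := Fact.out
  have P0 : 0 < p.toReal := ENNReal.toReal_pos (zero_lt_one.trans_le hp1).ne' hpt.ne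
  let L : Y →ₗ[𝕜] lp (fun _ : I => 𝕜) p :=
    { toFun := fun x => ⟨fun i => ζ i x, memℓp_gen' (h · x)⟩
      map_add' := fun a b => by
        apply lp.ext; funext i; exact map_add (ζ i) a b
      map_smul' := fun c a => by
        apply lp.ext; funext i; exact map_smul (ζ i) c a }
  have hb : ∀ x, ‖L x‖ ≤ C * ‖x‖ := fun x => lp.norm_le_of_forall_sum_le P0 (by positivity) fun t => h t x
  exact ⟨L.mkContinuous C hb, fun x i => rfl, L.mkContinuous_norm_le hC hb⟩

lemma norm_le_of_ee {Y : Type*} [NormedAddCommGroup Y] [NormedSpace 𝕜 Y] (hpt : p < ⊤)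
    (T : lp (fun _ : I => 𝕜) p →L[𝕜] Y) (δ : I → ℝ) (hδ : Summable δ) (h : ∀ i, ‖T (ee 𝕜 p i)‖ ≤ δ i) :
    ‖T‖ ≤ ∑' i, δ i := by
  have hp1 : 1 ≤ p := Fact.out
  have hd0 : ∀ i, 0 ≤ δ i := fun i => (norm_nonneg _).trans (h i)
  refine T.opNorm_le_bound (tsum_nonneg hd0) fun a => ?_
  have hs := (hasSum_ee hpt a).mapL T
  have hb : HasSum (fun i => δ i * ‖a‖) ((∑' i, δ i) * ‖a‖) := hδ.hasSum.mul_right _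
  rw [← hs.tsum_eq]
  refine tsum_of_norm_bounded hb fun i => ?_
  rw [map_smul, norm_smul, mul_comm]
  exact mul_le_mul (h i) (lp.norm_apply_le_norm (zero_lt_one.trans_le hp1).ne' a i) (norm_nonneg _) (hd0 i)

lemma retract_of_near {X Y : Type*} [NormedAddCommGroup X] [NormedSpace 𝕜 X] [CompleteSpace X]
    [NormedAddCommGroup Y] [NormedSpace 𝕜 Y] (J : X →L[𝕜] Y) (Pr : Y →L[𝕜] X)
    (h : ‖ContinuousLinearMap.id 𝕜 X - Pr.comp J‖ < 1) : ∃ R : Y →L[𝕜] X, R.comp J = ContinuousLinearMap.id 𝕜 X := by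
  let u := Units.oneSub (ContinuousLinearMap.id 𝕜 X - Pr.comp J) h
  have hu : (u : X →L[𝕜] X) = Pr.comp J := by
    change 1 - (ContinuousLinearMap.id 𝕜 X - Pr.comp J) = _
    change ContinuousLinearMap.id 𝕜 X - (ContinuousLinearMap.id 𝕜 X - Pr.comp J) = _
    rw [sub_sub_cancel]
  refine ⟨(↑u⁻¹ : X →L[𝕜] X).comp Pr, ?_⟩
  rw [ContinuousLinearMap.comp_assoc, ← hu]
  exact u.inv_mul

end
end APx

namespace APx
open Filter Topology

section
variable {𝕜 : Type*} [RCLike 𝕜] {p : ℝ≥0∞} [Fact (1 ≤ p)] {I : Type*}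

/-- truncation -/
def trc (𝕜 : Type*) [RCLike 𝕜] (p : ℝ≥0∞) [Fact (1 ≤ p)] (B : Finset ℕ) :
    lp (fun _ : ℕ => 𝕜) p →L[𝕜] lp (fun _ : ℕ => 𝕜) p :=
  ∑ m ∈ B, (lp.evalCLM 𝕜 (fun _ : ℕ => 𝕜) p m).smulRight (ee 𝕜 p m)

lemma trc_eq (B : Finset ℕ) (x : lp (fun _ : ℕ => 𝕜) p) : trc 𝕜 p B x = ∑ m ∈ B, x m • ee 𝕜 p m := by
  rw [trc, sum_apply]
  rfl

lemma trc_apply (B : Finset ℕ) (x : lp (fun _ : ℕ => 𝕜) p) (m : ℕ) :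
    trc 𝕜 p B x m = if m ∈ B then x m else 0 := by
  rw [trc_eq, lp.coeFn_sum, Finset.sum_apply]
  simp only [lp.coeFn_smul, Pi.smul_apply, smul_eq_mul]
  split_ifs with h
  · rw [Finset.sum_eq_single m, ee_self, mul_one]
    · intro j _ hj; rw [ee_ne hj.symm, mul_zero]
    · intro h'; exact absurd h h'
  · refine Finset.sum_eq_zero fun j hj => ?_
    have hmj : m ≠ j := by
      rintro rfl
      exact h hj
    rw [ee_ne hmj, mul_zero]

lemma trc_norm (P0 : 0 < p.toReal) (B : Finset ℕ) (x : lp (fun _ : ℕ => 𝕜) p) :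
    ‖trc 𝕜 p B x‖ ^ p.toReal = ∑ m ∈ B, ‖x m‖ ^ p.toReal := by
  have h := lp.norm_sum_single (E := fun _ : ℕ => 𝕜) (p := p) P0 x B
  rw [← h, trc_eq]
  congr 2
  refine Finset.sum_congr rfl fun i _ => ?_
  apply lp.ext
  funext j
  simp [ee, lp.single_apply, Pi.single_apply]

lemma trc_norm_le (P0 : 0 < p.toReal) (B : Finset ℕ) (x : lp (fun _ : ℕ => 𝕜) p) :
    ‖trc 𝕜 p B x‖ ≤ ‖x‖ := by
  rw [← Real.rpow_le_rpow_iff (norm_nonneg _) (norm_nonneg _) P0, trc_norm P0]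
  exact lp.sum_rpow_le_norm_rpow P0 x B

lemma exists_far (hpt : p < ⊤) (E : Submodule 𝕜 (lp (fun _ : ℕ => 𝕜) p)) (hE : ¬ FiniteDimensional 𝕜 E)
    (N : ℕ) (ε : ℝ) (hε : 0 < ε) : ∃ (M : ℕ) (y : lp (fun _ : ℕ => 𝕜) p), N ≤ M ∧ y ∈ E ∧ ‖y‖ = 1 ∧
      ‖y - trc 𝕜 p (Finset.Ico N M) y‖ ≤ ε := by
  obtain ⟨y, hyE, hy0, hy⟩ : ∃ y ∈ E, y ≠ 0 ∧ ∀ i < N, y i = 0 := by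
    let φ : E →ₗ[𝕜] (Fin N → 𝕜) := LinearMap.pi fun i =>
      ((lp.evalCLM 𝕜 (fun _ : ℕ => 𝕜) p i : lp (fun _ : ℕ => 𝕜) p →L[𝕜] 𝕜) : lp (fun _ : ℕ => 𝕜) p →ₗ[𝕜] 𝕜).comp E.subtype
    have hn : ¬ Function.Injective φ := fun hi => hE (FiniteDimensional.of_injective φ hi)
    rw [← LinearMap.ker_eq_bot, Submodule.eq_bot_iff] at hn
    push Not at hn
    obtain ⟨y, hy, hy0⟩ := hn
    refine ⟨y, y.2, fun h => hy0 (Subtype.ext h), fun i hi => ?_⟩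
    exact congrFun (LinearMap.mem_ker.1 hy) ⟨i, hi⟩
  have hny : ‖y‖ ≠ 0 := norm_ne_zero_iff.2 hy0
  set v : lp (fun _ : ℕ => 𝕜) p := ((‖y‖⁻¹ : ℝ) : 𝕜) • y with hv
  have hv1 : ‖v‖ = 1 := by
    rw [hv, norm_smul, RCLike.norm_ofReal, abs_of_nonneg (by positivity), inv_mul_cancel₀ hny]
  have hvN : ∀ i < N, v i = 0 := fun i hi => by
    rw [hv, lp.coeFn_smul, Pi.smul_apply, hy i hi, smul_zero]
  have ht := (hasSum_ee hpt v).tendsto_sum_nat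
  rw [Metric.tendsto_atTop] at ht
  obtain ⟨M, hM⟩ := ht ε hε
  refine ⟨max M N, v, le_max_right _ _, E.smul_mem _ hyE, hv1, ?_⟩
  have h1 := (hM (max M N) (le_max_left _ _)).le
  rw [dist_comm, dist_eq_norm, ← trc_eq] at h1
  have e : trc 𝕜 p (Finset.Ico N (max M N)) v = trc 𝕜 p (Finset.range (max M N)) v := by
    apply lp.ext
    funext m
    rw [trc_apply, trc_apply]
    by_cases hm : m < N
    · rw [hvN m hm]; simp
    · simp only [Finset.mem_Ico, Finset.mem_range, not_lt.1 hm, true_and]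
  rw [e]
  exact h1

lemma exists_blocks (hpt : p < ⊤) (E : Submodule 𝕜 (lp (fun _ : ℕ => 𝕜) p)) (hE : ¬ FiniteDimensional 𝕜 E) :
    ∃ (B : ℕ → Finset ℕ) (y : ℕ → lp (fun _ : ℕ => 𝕜) p), (∀ i j, i ≠ j → Disjoint (B i) (B j)) ∧
      (∀ k, y k ∈ E) ∧ (∀ k, ‖y k‖ = 1) ∧ ∀ k, ‖y k - trc 𝕜 p (B k) (y k)‖ ≤ (1 / 8) * (1 / 2) ^ k := by
  have h := fun (N k : ℕ) => exists_far hpt E hE N ((1 / 8) * (1 / 2) ^ k) (by positivity)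
  choose M y h1 h2 h3 h4 using h
  let N : ℕ → ℕ := fun k => Nat.rec 0 (fun k n => M n k) k
  have hN : ∀ k, N (k + 1) = M (N k) k := fun k => rfl
  have hmono : Monotone N := monotone_nat_of_le_succ fun k => by rw [hN]; exact h1 _ _
  refine ⟨fun k => Finset.Ico (N k) (N (k + 1)), fun k => y (N k) k, ?_, fun k => h2 _ _, fun k => h3 _ _, fun k => h4 _ _⟩
  have key : ∀ i j, i < j → Disjoint (Finset.Ico (N i) (N (i + 1))) (Finset.Ico (N j) (N (j + 1))) := by
    intro i j hij
    rw [Finset.disjoint_left]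
    intro m hm hm'
    have := hmono (show i + 1 ≤ j by omega)
    simp only [Finset.mem_Ico] at hm hm'
    omega
  intro i j hij
  rcases lt_or_gt_of_ne hij with h | h
  · exact key i j h
  · exact (key j i h).symm

theorem exists_retract [Countable I] (hp : 1 < p) (hpt : p < ⊤) (E : Submodule 𝕜 (lp (fun _ : ℕ => 𝕜) p))
    (hEc : IsClosed (E : Set (lp (fun _ : ℕ => 𝕜) p))) (hE : ¬ FiniteDimensional 𝕜 E) :
    ∃ (J : lp (fun _ : I => 𝕜) p →L[𝕜] E) (R : E →L[𝕜] lp (fun _ : I => 𝕜) p),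
      R.comp J = ContinuousLinearMap.id 𝕜 _ := by
  classical
  have P0 : 0 < p.toReal := ENNReal.toReal_pos (zero_lt_one.trans hp).ne' hpt.ne
  have P1 : 1 ≤ p.toReal := by
    rw [← ENNReal.toReal_one]; exact (ENNReal.toReal_le_toReal (by simp) hpt.ne).2 hp.le
  have : CompleteSpace E := hEc.completeSpace_coe
  obtain ⟨B', y', hB', hyE', hy1', hw'⟩ := exists_blocks hpt E hE
  obtain ⟨e, he⟩ := Countable.exists_injective_nat I
  let B : I → Finset ℕ := fun i => B' (e i)
  let y : I → lp (fun _ : ℕ => 𝕜) p := fun i => y' (e i)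
  have hB : ∀ i j, i ≠ j → Disjoint (B i) (B j) := fun i j h => hB' _ _ (he.ne h)
  let δ : I → ℝ := fun i => (1 / 8) * (1 / 2) ^ e i
  have hgeo : HasSum (fun k : ℕ => (1 / 8 : ℝ) * (1 / 2) ^ k) (1 / 8 * 2) := hasSum_geometric_two.mul_left _
  have hδs : Summable δ := hgeo.summable.comp_injective he
  have hδt : ∑' i, δ i ≤ 1 / 4 := by
    have : ∑' i, δ i ≤ ∑' k : ℕ, (1 / 8 : ℝ) * (1 / 2) ^ k :=
      tsum_comp_le_tsum_of_inj hgeo.summable (fun k => by positivity) he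
    rw [hgeo.tsum_eq] at this
    linarith
  have hδ0 : ∀ i, 0 ≤ δ i := fun i => by simp only [δ]; positivity
  have hδ1 : ∀ i, δ i ≤ 1 / 4 := fun i => (hδs.le_tsum i fun j _ => hδ0 j).trans hδt
  let z : I → lp (fun _ : ℕ => 𝕜) p := fun i => trc 𝕜 p (B i) (y i)
  have hy1 : ∀ i, ‖y i‖ = 1 := fun i => hy1' _
  have hw : ∀ i, ‖y i - z i‖ ≤ δ i := fun i => hw' _
  have hz1 : ∀ i, ‖z i‖ ≤ 1 := fun i => (trc_norm_le P0 _ _).trans (hy1 i).le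
  have hz2 : ∀ i, 1 / 2 ≤ ‖z i‖ := fun i => by
    have := norm_sub_norm_le (y i) (z i)
    linarith [hw i, hδ1 i, hy1 i]
  have hz0 : ∀ i, ‖z i‖ ≠ 0 := fun i => by
    have := hz2 i
    exact (by linarith : (0:ℝ) < ‖z i‖).ne'
  -- synthesis
  have hzs : ∀ (t : Finset I) (a : I → 𝕜), ‖∑ i ∈ t, a i • z i‖ ≤ (∑ i ∈ t, ‖a i‖ ^ p.toReal) ^ (1 / p.toReal) := by
    intro t a
    refine lp.norm_le_of_forall_sum_le P0 (by positivity) fun F => ?_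
    rw [← Real.rpow_mul (by positivity), one_div_mul_cancel P0.ne', Real.rpow_one]
    have hm : ∀ m, ‖(∑ i ∈ t, a i • z i : lp (fun _ : ℕ => 𝕜) p) m‖ ^ p.toReal ≤
        ∑ i ∈ t, ‖a i‖ ^ p.toReal * ‖z i m‖ ^ p.toReal := by
      intro m
      rw [lp.coeFn_sum, Finset.sum_apply]
      simp only [lp.coeFn_smul, Pi.smul_apply, smul_eq_mul]
      by_cases hc : ∃ i ∈ t, m ∈ B i
      · obtain ⟨i, hit, hi⟩ := hc
        rw [Finset.sum_eq_single i]
        · rw [norm_mul, Real.mul_rpow (norm_nonneg _) (norm_nonneg _)]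
          exact Finset.single_le_sum (f := fun i => ‖a i‖ ^ p.toReal * ‖z i m‖ ^ p.toReal)
            (fun j _ => by positivity) hit
        · intro j _ hj
          have : m ∉ B j := fun h => Finset.disjoint_left.1 (hB _ _ hj) h hi
          simp only [z, trc_apply, if_neg this, mul_zero]
        · intro h; exact absurd hit h
      · push Not at hc
        rw [Finset.sum_eq_zero, norm_zero, Real.zero_rpow P0.ne']
        · positivity
        · intro j hj
          simp only [z, trc_apply, if_neg (hc j hj), mul_zero]
    calc _ ≤ ∑ m ∈ F, ∑ i ∈ t, ‖a i‖ ^ p.toReal * ‖z i m‖ ^ p.toReal := Finset.sum_le_sum fun m _ => hm m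
      _ = ∑ i ∈ t, ‖a i‖ ^ p.toReal * ∑ m ∈ F, ‖z i m‖ ^ p.toReal := by
        rw [Finset.sum_comm]; simp only [Finset.mul_sum]
      _ ≤ ∑ i ∈ t, ‖a i‖ ^ p.toReal * 1 := by
        gcongr with i hi
        refine (lp.sum_rpow_le_norm_rpow P0 (z i) F).trans ?_
        exact Real.rpow_le_one (norm_nonneg _) (hz1 i) P0.le
      _ = _ := by simp only [mul_one]
  obtain ⟨J, hJ⟩ := synth (𝕜 := 𝕜) (p := p) hpt (fun i => (⟨y i, hyE' _⟩ : E)) 2 zero_le_two (by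
    intro t a
    set s := (∑ i ∈ t, ‖a i‖ ^ p.toReal) ^ (1 / p.toReal) with hs
    have hs0 : 0 ≤ s := by positivity
    have ha : ∀ i ∈ t, ‖a i‖ ≤ s := by
      intro i hi
      calc ‖a i‖ = (‖a i‖ ^ p.toReal) ^ (1 / p.toReal) := by
            rw [← Real.rpow_mul (norm_nonneg _), mul_one_div_cancel P0.ne', Real.rpow_one]
        _ ≤ s := by
          rw [hs]
          gcongr
          exact Finset.single_le_sum (f := fun i => ‖a i‖ ^ p.toReal) (fun j _ => by positivity) hi
    have e1 : ‖∑ i ∈ t, a i • (⟨y i, hyE' _⟩ : E)‖ = ‖∑ i ∈ t, a i • z i + ∑ i ∈ t, a i • (y i - z i)‖ := by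
      rw [← Finset.sum_add_distrib]
      simp only [← smul_add, add_sub_cancel]
      change ‖((∑ i ∈ t, a i • (⟨y i, hyE' _⟩ : E) : E) : lp (fun _ : ℕ => 𝕜) p)‖ = _
      rw [AddSubmonoidClass.coe_finsetSum]
      rfl
    rw [e1]
    have h2 : ‖∑ i ∈ t, a i • (y i - z i)‖ ≤ s * (1 / 4) := by
      calc _ ≤ ∑ i ∈ t, s * δ i := norm_sum_le_of_le _ fun i hi => by
            rw [norm_smul]; exact mul_le_mul (ha i hi) (hw i) (norm_nonneg _) hs0
        _ = s * ∑ i ∈ t, δ i := by rw [Finset.mul_sum]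
        _ ≤ _ := by
          gcongr
          exact (hδs.sum_le_tsum t fun i _ => hδ0 i).trans hδt
    have := norm_add_le (∑ i ∈ t, a i • z i) (∑ i ∈ t, a i • (y i - z i))
    linarith [hzs t a])
  -- analysis
  have hg : ∀ i, ∃ g : lp (fun _ : ℕ => 𝕜) p →L[𝕜] 𝕜, ‖g‖ = 1 ∧ g (z i) = (‖z i‖ : 𝕜) := fun i =>
    exists_dual_vector 𝕜 (z i) (hz0 i)
  choose g hg1 hg2 using hg
  let ζ : I → (lp (fun _ : ℕ => 𝕜) p →L[𝕜] 𝕜) := fun i => ((‖z i‖⁻¹ : ℝ) : 𝕜) • (g i).comp (trc 𝕜 p (B i))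
  have hζ : ∀ i x, ‖ζ i x‖ ≤ 2 * ‖trc 𝕜 p (B i) x‖ := by
    intro i x
    change ‖((‖z i‖⁻¹ : ℝ) : 𝕜) * g i (trc 𝕜 p (B i) x)‖ ≤ _
    rw [norm_mul, RCLike.norm_ofReal, abs_of_nonneg (by positivity)]
    have a1 : ‖z i‖⁻¹ ≤ 2 := by
      rw [inv_le_comm₀ (by linarith [hz2 i]) two_pos]; linarith [hz2 i]
    have a2 := (g i).le_opNorm (trc 𝕜 p (B i) x)
    rw [hg1, one_mul] at a2
    gcongr
  have hζz : ∀ i j, ζ i (z j) = if i = j then 1 else 0 := by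
    intro i j
    change ((‖z i‖⁻¹ : ℝ) : 𝕜) * g i (trc 𝕜 p (B i) (z j)) = _
    split_ifs with h
    · subst h
      have : trc 𝕜 p (B i) (z i) = z i := by
        apply lp.ext; funext m
        simp only [z, trc_apply]
        split_ifs <;> rfl
      rw [this, hg2, ← RCLike.ofReal_mul, inv_mul_cancel₀ (hz0 i), RCLike.ofReal_one]
    · have : trc 𝕜 p (B i) (z j) = 0 := by
        apply lp.ext; funext m
        simp only [z, trc_apply]
        split_ifs with h1 h2
        · exact absurd h2 (Finset.disjoint_left.1 (hB _ _ h) h1)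
        · rfl
        · rfl
      rw [this, map_zero, mul_zero]
  obtain ⟨Pr, hPr, hPrn⟩ := anal (p := p) hpt ζ 2 zero_le_two (by
    intro t x
    calc _ ≤ ∑ i ∈ t, (2 * ‖trc 𝕜 p (B i) x‖) ^ p.toReal := by
          gcongr with i hi; exact hζ i x
      _ = 2 ^ p.toReal * ∑ i ∈ t, ∑ m ∈ B i, ‖x m‖ ^ p.toReal := by
          rw [Finset.mul_sum]
          refine Finset.sum_congr rfl fun i _ => ?_
          rw [Real.mul_rpow (by norm_num) (norm_nonneg _), trc_norm P0]
      _ = 2 ^ p.toReal * ∑ m ∈ t.biUnion B, ‖x m‖ ^ p.toReal := by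
          rw [Finset.sum_biUnion]
          intro i _ j _ hij
          exact hB i j hij
      _ ≤ 2 ^ p.toReal * ‖x‖ ^ p.toReal := by
          gcongr
          exact lp.sum_rpow_le_norm_rpow P0 x _
      _ = _ := by rw [Real.mul_rpow (by norm_num) (norm_nonneg _)])
  have hPrz : ∀ j, Pr (z j) = ee 𝕜 p j := by
    intro j
    apply lp.ext; funext i
    rw [hPr, hζz]
    split_ifs with h
    · rw [h, ee_self]
    · rw [ee_ne h]
  obtain ⟨R, hR⟩ := retract_of_near J (Pr.comp E.subtypeL) (by
    have hs2 : Summable fun i => 2 * δ i := hδs.mul_left 2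
    have := norm_le_of_ee hpt (ContinuousLinearMap.id 𝕜 (lp (fun _ : I => 𝕜) p) - (Pr.comp E.subtypeL).comp J) (fun i => 2 * δ i) hs2 (by
      intro i
      have e2 : (ContinuousLinearMap.id 𝕜 (lp (fun _ : I => 𝕜) p) - (Pr.comp E.subtypeL).comp J) (ee 𝕜 p i) = - Pr (y i - z i) := by
        rw [map_sub, hPrz]
        change ee 𝕜 p i - Pr (J (ee 𝕜 p i) : lp (fun _ : ℕ => 𝕜) p) = _
        rw [hJ]; abel
      rw [e2, norm_neg]
      refine (Pr.le_opNorm _).trans ?_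
      exact mul_le_mul hPrn (hw i) (norm_nonneg _) zero_le_two)
    refine this.trans_lt ?_
    rw [tsum_mul_left]
    linarith)
  exact ⟨J, R, hR⟩

end
end APx

namespace APx

theorem hasAP_retract {𝕜 X Y : Type*} [RCLike 𝕜] [SeminormedAddCommGroup X] [NormedSpace 𝕜 X]
    [SeminormedAddCommGroup Y] [NormedSpace 𝕜 Y] (i : X →L[𝕜] Y) (r : Y →L[𝕜] X)
    (h : ∀ x, r (i x) = x) (hY : HasAP 𝕜 Y) : HasAP 𝕜 X := by
  intro K hK ε hε
  have hc : 0 < ‖r‖ + 1 := by positivity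
  obtain ⟨T, hT, hTK⟩ := hY (i '' K) (hK.image i.continuous) (ε / (‖r‖ + 1)) (by positivity)
  refine ⟨r.comp (T.comp i), ?_, ?_⟩
  · have hle : LinearMap.range ((r.comp (T.comp i) : X →L[𝕜] X) : X →ₗ[𝕜] X) ≤
        (LinearMap.range (T : Y →ₗ[𝕜] Y)).map (r : Y →ₗ[𝕜] X) := by
      rintro _ ⟨x, rfl⟩
      exact ⟨T (i x), ⟨i x, rfl⟩, rfl⟩
    exact Submodule.finiteDimensional_of_le hle
  · intro x hx
    have h1 := hTK (i x) ⟨x, hx, rfl⟩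
    have e : (r.comp (T.comp i)) x - x = r (T (i x) - i x) := by
      rw [map_sub, h]; rfl
    rw [e]
    calc _ ≤ ‖r‖ * ‖T (i x) - i x‖ := r.le_opNorm _
      _ ≤ (‖r‖ + 1) * ‖T (i x) - i x‖ := by gcongr; linarith
      _ < (‖r‖ + 1) * (ε / (‖r‖ + 1)) := by gcongr
      _ = ε := by field_simp

/-- the two-sided composition operator -/
def sand {𝕜 X X' Y Y' : Type*} [RCLike 𝕜] [NormedAddCommGroup X] [NormedSpace 𝕜 X]
    [NormedAddCommGroup Y] [NormedSpace 𝕜 Y] [NormedAddCommGroup X'] [NormedSpace 𝕜 X']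
    [NormedAddCommGroup Y'] [NormedSpace 𝕜 Y'] (A : X' →L[𝕜] X) (B : Y →L[𝕜] Y') :
    (X →L[𝕜] Y) →L[𝕜] (X' →L[𝕜] Y') :=
  (ContinuousLinearMap.compL 𝕜 X' Y Y' B).comp ((ContinuousLinearMap.compL 𝕜 X' X Y).flip A)

end APx

/-- If `1 < p ≤ q < ∞` and `E`, `F` are closed infinite dimensional subspaces of `ℓ_p` and
`ℓ_q` respectively, then `L(E;F)` fails the approximation property. -/
theorem not_ap_opSpace_subspaces (𝕜 : Type*) [RCLike 𝕜] (p q : ℝ≥0∞)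
    [Fact (1 ≤ p)] [Fact (1 ≤ q)] (hp : 1 < p) (hpq : p ≤ q) (hq : q < ⊤)
    (E : Submodule 𝕜 (lp (fun _ : ℕ => 𝕜) p)) (F : Submodule 𝕜 (lp (fun _ : ℕ => 𝕜) q))
    (hEc : IsClosed (E : Set (lp (fun _ : ℕ => 𝕜) p)))
    (hFc : IsClosed (F : Set (lp (fun _ : ℕ => 𝕜) q)))
    (hEinf : ¬ FiniteDimensional 𝕜 E) (hFinf : ¬ FiniteDimensional 𝕜 F) :
    ¬ HasAP 𝕜 (E →L[𝕜] F) := by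
  intro hAP
  have hcount : Countable APx.IX := by unfold APx.IX; infer_instance
  obtain ⟨JE, RE, hE⟩ := APx.exists_retract (I := APx.IX) hp (hpq.trans_lt hq) E hEc hEinf
  obtain ⟨JF, RF, hF⟩ := APx.exists_retract (I := APx.IX) (hp.trans_le hpq) hq F hFc hFinf
  refine APx.not_ap_LL (𝕜 := 𝕜) hp hpq hq
    (APx.hasAP_retract (APx.sand RE JF) (APx.sand JE RF) (fun u => ?_) hAP)
  apply ContinuousLinearMap.ext
  intro x
  have h1 := fun x => DFunLike.congr_fun hE x
  have h2 := fun x => DFunLike.congr_fun hF x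
  change RF (JF (u (RE (JE x)))) = u x
  have h1 : RE (JE x) = x := h1 x
  rw [h1]
  exact h2 (u x)
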